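/- arXiv:math/0002171 — 5 statements merged into one kernel-verified Lean document; each statement's English description precedes it below -/
import Mathlib

section
/- Let m, ℓ, r_1, …, r_ℓ be positive integers with 1 ≤ r_1 < r_2 < ⋯ < r_ℓ ≤ m and gcd(r_1, …, r_ℓ, m) = 1. Let A be the set of all positive integers a such that a ≡ r_i (mod m) for some i ∈ {1, …, ℓ}, and let p_A(n) denote the number of partitions of n into parts belonging to A. Then log p_A(n) ∼ π√(2ℓn/(3m)) as n → ∞, i.e., the ratio log p_A(n) / (π√(2ℓn/(3m))) tends to 1. -/
open Filter Real

/-- The number of partitions of `n` into parts belonging to the set `A`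
(with `partCount A 0 = 1`, the empty partition). -/
noncomputable def partCount (A : Set ℕ) (n : ℕ) : ℕ :=
  Nat.card {p : n.Partition // ∀ i ∈ p.parts, i ∈ A}

theorem partCount_eq_card_restricted (A : Set ℕ) [DecidablePred (· ∈ A)] (n : ℕ) :
    partCount A n = (Nat.Partition.restricted n (· ∈ A)).card := by
  rw [partCount, Nat.card_eq_fintype_card, Fintype.card_subtype, Nat.Partition.restricted]

theorem partCount_mono {A B : Set ℕ} (h : A ⊆ B) (n : ℕ) : partCount A n ≤ partCount B n :=
  Nat.card_le_card_of_injective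
    (fun p : {p : n.Partition // ∀ i ∈ p.parts, i ∈ A} =>
      (⟨p.1, fun i hi => h (p.2 i hi)⟩ : {p : n.Partition // ∀ i ∈ p.parts, i ∈ B}))
    fun p q hpq => Subtype.ext (by simpa using hpq)

theorem partCount_inter_Icc {n N : ℕ} (h : n ≤ N) (A : Set ℕ) :
    partCount (A ∩ Set.Icc 1 N) n = partCount A n := by
  refine Nat.card_congr (Equiv.subtypeEquivRight fun p => ?_)
  refine forall₂_congr fun i hi => ?_
  have h1 := p.parts_pos hi
  have h2 : i ≤ n := p.le_of_mem_parts hi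
  simp only [Set.mem_inter_iff, Set.mem_Icc]
  constructor
  · exact fun h => h.1
  · exact fun hA => ⟨hA, h1, h2.trans h⟩

theorem partCount_le_partCount_add {A : Set ℕ} {a : ℕ} (ha : a ∈ A) (ha0 : 0 < a) (n : ℕ) :
    partCount A n ≤ partCount A (n + a) := by
  refine Nat.card_le_card_of_injective
    (fun p : {p : n.Partition // ∀ i ∈ p.parts, i ∈ A} =>
      (⟨⟨a ::ₘ p.1.parts, ?_, ?_⟩, ?_⟩ :
        {p : (n + a).Partition // ∀ i ∈ p.parts, i ∈ A})) ?_
  · intro i hi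
    rcases Multiset.mem_cons.1 hi with rfl | hi
    · exact ha0
    · exact p.1.parts_pos hi
  · rw [Multiset.sum_cons, p.1.parts_sum, add_comm]
  · intro i hi
    rcases Multiset.mem_cons.1 hi with rfl | hi
    · exact ha
    · exact p.2 i hi
  · intro p q hpq
    have := congrArg (fun x => x.1.parts) hpq
    exact Subtype.ext (Nat.Partition.ext (Multiset.cons_inj_right a |>.1 this))

theorem partCount_le_partCount_add_of_mem_closure {A : Set ℕ} (hA : ∀ a ∈ A, 0 < a) {k : ℕ}
    (hk : k ∈ AddSubmonoid.closure A) (n : ℕ) : partCount A n ≤ partCount A (n + k) := by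
  induction hk using AddSubmonoid.closure_induction generalizing n with
  | mem a ha => exact partCount_le_partCount_add ha (hA a ha) n
  | zero => simp
  | add a b _ _ iha ihb => exact (iha n).trans (by simpa [add_assoc] using ihb (n + a))

theorem partCount_zero (A : Set ℕ) : partCount A 0 = 1 := by
  classical
  rw [partCount_eq_card_restricted, Nat.Partition.restricted, Finset.filter_true_of_mem]
  · simp
  · intro p _ i hi
    have := p.parts_pos hi
    have := p.le_of_mem_parts hi
    omega

open PowerSeries in
theorem hasSum_coeff_mul {f g : ℝ⟦X⟧} {x F G : ℝ}
    (hf : HasSum (fun n => coeff n f * x ^ n) F) (hg : HasSum (fun n => coeff n g * x ^ n) G) :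
    HasSum (fun n => coeff n (f * g) * x ^ n) (F * G) := by
  have hf' := hf.summable.norm
  have hg' := hg.summable.norm
  have key : (fun n => coeff n (f * g) * x ^ n) = fun n =>
      ∑ kl ∈ Finset.HasAntidiagonal.antidiagonal n,
        (coeff kl.1 f * x ^ kl.1) * (coeff kl.2 g * x ^ kl.2) := by
    funext n
    rw [coeff_mul, Finset.sum_mul]
    refine Finset.sum_congr rfl fun kl hkl => ?_
    rw [← Finset.HasAntidiagonal.mem_antidiagonal.1 hkl, pow_add]
    ring
  rw [key, ← hf.tsum_eq, ← hg.tsum_eq,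
    tsum_mul_tsum_eq_tsum_sum_antidiagonal_of_summable_norm hf' hg']
  exact (summable_norm_sum_mul_antidiagonal_of_summable_norm hf' hg').of_norm.hasSum

open PowerSeries in
theorem hasSum_coeff_prod {ι : Type*} (s : Finset ι) {f : ι → ℝ⟦X⟧} {x : ℝ} {F : ι → ℝ}
    (hf : ∀ i ∈ s, HasSum (fun n => coeff n (f i) * x ^ n) (F i)) :
    HasSum (fun n => coeff n (∏ i ∈ s, f i) * x ^ n) (∏ i ∈ s, F i) := by
  classical
  induction s using Finset.induction_on with
  | empty =>
    have h : (fun n => coeff n (∏ i ∈ (∅ : Finset ι), f i) * x ^ n) =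
        fun n => if n = 0 then 1 else 0 := by
      funext n
      rcases eq_or_ne n 0 with rfl | hn <;> simp [coeff_one, *]
    rw [h, Finset.prod_empty]
    exact hasSum_ite_eq 0 1
  | insert i s hi ih =>
    rw [Finset.prod_insert hi, Finset.prod_insert hi]
    exact hasSum_coeff_mul (hf i (Finset.mem_insert_self i s))
      (ih fun j hj => hf j (Finset.mem_insert_of_mem hj))

open PowerSeries PowerSeries.WithPiTopology in
theorem coeff_tsum_X_pow_mul {a : ℕ} (ha : 0 < a) (n : ℕ) :
    coeff n (∑' j : ℕ, (X : ℝ⟦X⟧) ^ (a * j)) = if a ∣ n then 1 else 0 := by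
  have hs : Summable fun j : ℕ => (X : ℝ⟦X⟧) ^ (a * j) := by
    simp_rw [pow_mul]
    exact summable_pow_of_constantCoeff_eq_zero (by simp [ha.ne'])
  rw [hs.map_tsum _ (WithPiTopology.continuous_coeff _ _)]
  simp only [coeff_X_pow]
  split_ifs with h
  · obtain ⟨k, rfl⟩ := h
    rw [tsum_eq_single k]
    · simp
    · intro j hj
      rw [if_neg]
      exact fun h => hj (Nat.eq_of_mul_eq_mul_left ha h).symm
  · convert tsum_zero with j
    rw [if_neg]
    rintro rfl
    exact h (dvd_mul_right _ _)

open PowerSeries PowerSeries.WithPiTopology in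
theorem hasSum_coeff_tsum_X_pow_mul {a : ℕ} (ha : 0 < a) {x : ℝ} (hx0 : 0 ≤ x) (hx1 : x < 1) :
    HasSum (fun n => coeff n (∑' j : ℕ, (X : ℝ⟦X⟧) ^ (a * j)) * x ^ n) (1 - x ^ a)⁻¹ := by
  simp_rw [coeff_tsum_X_pow_mul ha]
  have hinj : Function.Injective fun j : ℕ => a * j := fun i j h =>
    Nat.eq_of_mul_eq_mul_left ha h
  rw [← hinj.hasSum_iff]
  · simpa [Function.comp_def, pow_mul] using
      hasSum_geometric_of_lt_one (pow_nonneg hx0 a) (pow_lt_one₀ hx0 hx1 ha.ne')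
  · intro n hn
    rw [if_neg, zero_mul]
    rintro ⟨k, rfl⟩
    exact hn ⟨k, rfl⟩

open PowerSeries PowerSeries.WithPiTopology in
theorem hasSum_partCount_finset (S : Finset ℕ) (hS : 0 ∉ S) {x : ℝ} (hx0 : 0 ≤ x) (hx1 : x < 1) :
    HasSum (fun n => (partCount S n : ℝ) * x ^ n) (∏ a ∈ S, (1 - x ^ a)⁻¹) := by
  classical
  have h1 := Nat.Partition.hasProd_powerSeriesMk_card_restricted ℝ (· ∈ (S : Set ℕ))
  have hS' : ∀ a ∈ S, a - 1 + 1 = a := fun a ha =>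
    Nat.sub_add_cancel (Nat.pos_of_ne_zero fun h => hS (h ▸ ha))
  have h2 := hasProd_prod_of_ne_finset_one (L := .unconditional ℕ) (s := S.image (· - 1))
    (f := fun i => if i + 1 ∈ (S : Set ℕ) then ∑' j : ℕ, (X : ℝ⟦X⟧) ^ ((i + 1) * j) else 1)
    (fun i hi => if_neg fun h => hi (Finset.mem_image.2 ⟨i + 1, h, rfl⟩))
  have h3 := h1.unique h2
  rw [Finset.prod_image fun a ha b hb hab => by
    rw [← hS' a ha, ← hS' b hb]; exact congrArg (· + 1) hab] at h3
  have h4 : (PowerSeries.mk fun n => (partCount S n : ℝ)) =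
      ∏ a ∈ S, ∑' j : ℕ, (X : ℝ⟦X⟧) ^ (a * j) := by
    simp_rw [partCount_eq_card_restricted]
    refine h3.trans (Finset.prod_congr rfl fun a ha => ?_)
    rw [hS' a ha, if_pos (Finset.mem_coe.2 ha)]
  have h5 := hasSum_coeff_prod S (x := x) fun a ha =>
    hasSum_coeff_tsum_X_pow_mul (Nat.pos_of_ne_zero fun h => hS (h ▸ ha)) hx0 hx1
  rw [← h4] at h5
  simpa using h5

/-- Euler's product for the generating function of partitions into parts from `A`. -/
theorem hasSum_partCount {A : Set ℕ} (hA : 0 ∉ A) {x G : ℝ} (hx0 : 0 ≤ x) (hx1 : x < 1)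
    (hG : HasSum (A.indicator fun a => -log (1 - x ^ a)) G) :
    HasSum (fun n => (partCount A n : ℝ) * x ^ n) (exp G) := by
  classical
  have hnn : ∀ a, 0 ≤ A.indicator (fun a => -log (1 - x ^ a)) a := fun a =>
    Set.indicator_nonneg (fun a _ => neg_nonneg.2 (log_nonpos
      (sub_nonneg.2 (pow_le_one₀ hx0 hx1.le)) (sub_le_self _ (pow_nonneg hx0 a)))) a
  have hterm : ∀ (B : Set ℕ) n, 0 ≤ (partCount B n : ℝ) * x ^ n := fun B n => by positivity
  let S : ℕ → Finset ℕ := fun N => (Finset.Icc 1 N).filter (· ∈ A)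
  have hS : ∀ N, (S N : Set ℕ) = A ∩ Set.Icc 1 N := fun N => by
    ext a
    simp only [S, Finset.coe_filter, Finset.mem_Icc, Set.mem_ofPred_eq, Set.mem_inter_iff,
      Set.mem_Icc, and_comm]
  have hprod : ∀ N, HasSum (fun n => (partCount (A ∩ Set.Icc 1 N) n : ℝ) * x ^ n)
      (exp (∑ a ∈ Finset.range (N + 1), A.indicator (fun a => -log (1 - x ^ a)) a)) := by
    intro N
    have h := hasSum_partCount_finset (S N) (by simp [S]) hx0 hx1
    rw [hS] at h
    convert h using 1
    rw [Finset.sum_indicator_eq_sum_filter, exp_sum]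
    have : (Finset.range (N + 1)).filter (· ∈ A) = S N := by
      ext a
      simp only [S, Finset.mem_filter, Finset.mem_range, Finset.mem_Icc]
      constructor
      · rintro ⟨h1, h2⟩
        exact ⟨⟨Nat.pos_of_ne_zero fun h => hA (h ▸ h2), by omega⟩, h2⟩
      · rintro ⟨h1, h2⟩
        exact ⟨by omega, h2⟩
    rw [this]
    refine Finset.prod_congr rfl fun a ha => ?_
    have ha1 : a ≠ 0 := by simp [S] at ha; omega
    rw [exp_neg, exp_log (sub_pos.2 (pow_lt_one₀ hx0 hx1 ha1))]
  have hle : ∀ K, ∑ n ∈ Finset.range K, (partCount A n : ℝ) * x ^ n ≤ exp G := by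
    intro K
    calc ∑ n ∈ Finset.range K, (partCount A n : ℝ) * x ^ n
        = ∑ n ∈ Finset.range K, (partCount (A ∩ Set.Icc 1 K) n : ℝ) * x ^ n :=
          Finset.sum_congr rfl fun n hn => by
            rw [partCount_inter_Icc (Finset.mem_range.1 hn).le]
      _ ≤ _ := sum_le_hasSum _ (fun n _ => hterm _ n) (hprod K)
      _ ≤ exp G := exp_le_exp.2 (sum_le_hasSum _ (fun a _ => hnn a) hG)
  have hsum : Summable fun n => (partCount A n : ℝ) * x ^ n :=
    summable_of_sum_range_le (hterm A) hle
  have hupper := hsum.tsum_le_of_sum_range_le hle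
  have hlower : exp G ≤ ∑' n, (partCount A n : ℝ) * x ^ n := by
    refine le_of_tendsto ((continuous_exp.tendsto G).comp
      (hG.tendsto_sum_nat.comp (tendsto_add_atTop_nat 1))) (Eventually.of_forall fun N => ?_)
    refine hasSum_le (fun n => ?_) (hprod N) hsum.hasSum
    gcongr
    exact partCount_mono Set.inter_subset_left n
  rw [← le_antisymm hupper hlower]
  exact hsum.hasSum

theorem mul_exp_neg_div_one_sub_exp_neg_le_one {r m u : ℝ} (hr : 1 ≤ r) (hm : 1 ≤ m)
    (hu : 0 < u) : u * (exp (-(u * r)) / (1 - exp (-(u * m)))) ≤ 1 := by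
  have h1 : exp (-(u * r)) ≤ (1 + u)⁻¹ := by
    rw [exp_neg]
    have := add_one_le_exp (u * r)
    gcongr
    nlinarith
  have h2 : exp (-(u * m)) ≤ (1 + u * m)⁻¹ := by
    rw [exp_neg]
    have := add_one_le_exp (u * m)
    gcongr
    linarith
  have hum : 0 < u * m := by positivity
  have h3 : u * m / (1 + u * m) ≤ 1 - exp (-(u * m)) := by
    have : u * m / (1 + u * m) = 1 - (1 + u * m)⁻¹ := by field_simp; ring
    linarith
  have h4 : 0 < u * m / (1 + u * m) := by positivity
  calc u * (exp (-(u * r)) / (1 - exp (-(u * m))))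
      ≤ u * ((1 + u)⁻¹ / (u * m / (1 + u * m))) := by gcongr
    _ = (1 + u * m) / (m + u * m) := by field_simp
    _ ≤ 1 := by
      rw [div_le_one (by positivity)]
      linarith

theorem tendsto_mul_exp_neg_div_one_sub_exp_neg (r : ℝ) {m : ℝ} (hm : 0 < m) :
    Tendsto (fun u : ℝ => u * (exp (-(u * r)) / (1 - exp (-(u * m)))))
      (nhdsWithin 0 (Set.Ioi 0)) (nhds m⁻¹) := by
  have hd : HasDerivAt (fun u : ℝ => 1 - exp (-(u * m))) m 0 := by
    have := (((hasDerivAt_id (0 : ℝ)).mul_const m).neg.exp).const_sub 1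
    simpa using this
  have hs := (hasDerivAt_iff_tendsto_slope.1 hd).mono_left
    (nhdsWithin_mono 0 fun u (hu : 0 < u) => hu.ne')
  have he : Tendsto (fun u : ℝ => exp (-(u * r))) (nhdsWithin 0 (Set.Ioi 0)) (nhds 1) := by
    have : Continuous fun u : ℝ => exp (-(u * r)) := by fun_prop
    simpa using (this.tendsto 0).mono_left nhdsWithin_le_nhds
  have := he.mul (hs.inv₀ hm.ne')
  rw [one_mul] at this
  refine this.congr fun u => ?_
  simp only [slope_def_field, sub_zero, zero_mul, neg_zero, exp_zero, sub_self, inv_div]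
  ring

/-- The Lambert series expressing the logarithm of `∏ₖ (1 - exp (-t (r + m k)))⁻¹`. -/
noncomputable def logProdSeries (r m t : ℝ) : ℝ :=
  ∑' j : ℕ, exp (-((j + 1) * t * r)) / (1 - exp (-((j + 1) * t * m))) / (j + 1)

theorem summable_one_div_succ_sq : Summable fun j : ℕ => 1 / ((j : ℝ) + 1) ^ 2 := by
  have := (summable_nat_add_iff 1).2 (Real.summable_one_div_nat_pow.2 one_lt_two)
  simpa using this

theorem term_logProdSeries_nonneg {r m t : ℝ} (hm : 1 ≤ m) (ht : 0 < t) (j : ℕ) :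
    0 ≤ exp (-((j + 1) * t * r)) / (1 - exp (-((j + 1) * t * m))) / (j + 1) := by
  have : exp (-((j + 1) * t * m)) ≤ 1 := exp_le_one_iff.2 (by
    have : 0 ≤ (j + 1) * t * m := by positivity
    linarith)
  have := sub_nonneg.2 this
  positivity

theorem mul_term_logProdSeries_le {r m t : ℝ} (hr : 1 ≤ r) (hm : 1 ≤ m) (ht : 0 < t) (j : ℕ) :
    t * (exp (-((j + 1) * t * r)) / (1 - exp (-((j + 1) * t * m))) / (j + 1)) ≤
      1 / ((j : ℝ) + 1) ^ 2 := by
  have h := mul_exp_neg_div_one_sub_exp_neg_le_one hr hm (u := (j + 1) * t) (by positivity)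
  rw [le_div_iff₀ (by positivity)]
  calc _ = (j + 1) * t * (exp (-((j + 1) * t * r)) / (1 - exp (-((j + 1) * t * m)))) := by
        field_simp
    _ ≤ 1 := h

theorem summable_logProdSeries {r m t : ℝ} (hr : 1 ≤ r) (hm : 1 ≤ m) (ht : 0 < t) :
    Summable fun j : ℕ =>
      exp (-((j + 1) * t * r)) / (1 - exp (-((j + 1) * t * m))) / ((j : ℝ) + 1) := by
  have h : Summable fun j : ℕ =>
      t * (exp (-((j + 1) * t * r)) / (1 - exp (-((j + 1) * t * m))) / ((j : ℝ) + 1)) :=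
    Summable.of_nonneg_of_le
      (fun j => mul_nonneg ht.le (term_logProdSeries_nonneg hm ht j))
      (fun j => mul_term_logProdSeries_le hr hm ht j) summable_one_div_succ_sq
  exact (summable_mul_left_iff ht.ne').1 h

theorem hasSum_neg_log_one_sub_exp {r m t : ℝ} (hr : 1 ≤ r) (hm : 1 ≤ m) (ht : 0 < t) :
    HasSum (fun k : ℕ => -log (1 - exp (-(t * (r + m * k))))) (logProdSeries r m t) := by
  let f : ℕ × ℕ → ℝ := fun q => exp (-(t * (r + m * q.2))) ^ (q.1 + 1) / (q.1 + 1)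
  have hfj : ∀ j : ℕ, HasSum (fun k => f (j, k))
      (exp (-((j + 1) * t * r)) / (1 - exp (-((j + 1) * t * m))) / (j + 1)) := by
    intro j
    have hlt : exp (-((j + 1) * t * m)) < 1 := exp_lt_one_iff.2 (by
      have : 0 < (j + 1) * t * m := by positivity
      linarith)
    have := ((hasSum_geometric_of_lt_one (exp_pos _).le hlt).mul_left
      (exp (-((j + 1) * t * r)))).div_const ((j : ℝ) + 1)
    rw [← div_eq_mul_inv] at this
    refine (congrArg (HasSum · _) (funext fun k => ?_)).mpr this
    simp only [f]
    rw [← exp_nat_mul, ← exp_nat_mul, ← exp_add]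
    congr 2
    push_cast
    ring
  have hfk : ∀ k : ℕ, HasSum (fun j => f (j, k)) (-log (1 - exp (-(t * (r + m * k))))) := by
    intro k
    refine hasSum_pow_div_log_of_abs_lt_one (x := exp (-(t * (r + m * k)))) ?_
    rw [abs_of_pos (exp_pos _), exp_lt_one_iff]
    have : 0 < t * (r + m * k) := by positivity
    linarith
  have hs : Summable f := by
    rw [summable_prod_of_nonneg fun q => by positivity]
    refine ⟨fun j => (hfj j).summable, ?_⟩
    simp_rw [fun j => (hfj j).tsum_eq]
    exact summable_logProdSeries hr hm ht
  have hval : ∑' q, f q = logProdSeries r m t :=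
    (hs.hasSum.prod_fiberwise hfj).tsum_eq.symm
  have hswap : HasSum (f ∘ Prod.swap) (logProdSeries r m t) := by
    rw [← hval]
    exact (Equiv.prodComm ℕ ℕ).hasSum_iff.2 hs.hasSum
  exact hswap.prod_fiberwise hfk

theorem tendsto_mul_logProdSeries {r m : ℝ} (hr : 1 ≤ r) (hm : 1 ≤ m) :
    Tendsto (fun t => t * logProdSeries r m t) (nhdsWithin 0 (Set.Ioi 0))
      (nhds (π ^ 2 / 6 / m)) := by
  have hz : HasSum (fun j : ℕ => m⁻¹ * (1 / ((j : ℝ) + 1) ^ 2)) (π ^ 2 / 6 / m) := by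
    have h := (hasSum_nat_add_iff' 1).2 hasSum_zeta_two
    rw [div_eq_inv_mul _ m]
    refine HasSum.mul_left _ ?_
    simpa using h
  rw [← hz.tsum_eq]
  simp_rw [logProdSeries, ← tsum_mul_left]
  refine tendsto_tsum_of_dominated_convergence summable_one_div_succ_sq (fun j => ?_) ?_
  · have hj : (0 : ℝ) < j + 1 := by positivity
    have hlin : Tendsto (fun t : ℝ => (j + 1) * t) (nhdsWithin 0 (Set.Ioi 0))
        (nhdsWithin 0 (Set.Ioi 0)) := by
      refine tendsto_nhdsWithin_iff.2 ⟨?_, ?_⟩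
      · have : Continuous fun t : ℝ => ((j : ℝ) + 1) * t := by fun_prop
        simpa using (this.tendsto 0).mono_left nhdsWithin_le_nhds
      · filter_upwards [self_mem_nhdsWithin] with t ht
        exact mul_pos hj ht
    have h := ((tendsto_mul_exp_neg_div_one_sub_exp_neg r (by linarith : 0 < m)).comp
      hlin).mul_const (1 / ((j : ℝ) + 1) ^ 2)
    refine h.congr fun t => ?_
    simp only [Function.comp]
    field_simp
  · filter_upwards [self_mem_nhdsWithin] with t ht j
    rw [norm_of_nonneg (mul_nonneg (le_of_lt ht) (term_logProdSeries_nonneg hm ht j))]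
    exact mul_term_logProdSeries_le hr hm ht j

theorem eventually_exp_le_quarter_exp {u v : ℝ → ℝ} {α β : ℝ} (hαβ : α < β)
    (hu : Tendsto (fun t => t * u t) (nhdsWithin 0 (Set.Ioi 0)) (nhds α))
    (hv : Tendsto (fun t => t * v t) (nhdsWithin 0 (Set.Ioi 0)) (nhds β)) :
    ∀ᶠ t in nhdsWithin 0 (Set.Ioi 0), exp (u t) ≤ exp (v t) / 4 := by
  have h := (hv.sub hu).pos_mul_atTop (sub_pos.2 hαβ) tendsto_inv_nhdsGT_zero
  filter_upwards [h.eventually_ge_atTop (log 4), self_mem_nhdsWithin] with t ht ht0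
  have ht0' : t ≠ 0 := ne_of_gt ht0
  have : (t * v t - t * u t) * t⁻¹ = v t - u t := by field_simp
  rw [this] at ht
  rw [le_div_iff₀ (by norm_num), ← exp_log (show (0 : ℝ) < 4 by norm_num), ← exp_add]
  exact exp_le_exp.2 (by linarith)

/-- Splitting a Laplace sum at `N₁` and `M`, the two tails being estimated by exponential tilting
and the middle part by almost monotonicity. -/
theorem laplace_le_tails_add_middle {p : ℕ → ℝ} (hp : ∀ n, 0 ≤ p n) {L : ℝ → ℝ}
    (hL : ∀ t > 0, HasSum (fun n => p n * exp (-t * n)) (L t)) {k₀ : ℕ}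
    (hmono : ∀ j n, j + k₀ ≤ n → p j ≤ p n) {s t s' N₁ N₂ : ℝ} {M n : ℕ} (hs' : 0 < s')
    (hs't : s' ≤ t) (hts : t ≤ s) (hN₂ : N₂ ≤ M) (hM : M + k₀ ≤ n) :
    L t ≤ exp ((s - t) * N₁) * L s + exp (-(t - s') * N₂) * L s' +
      M * (p n * exp (-t * N₁)) := by
  have h1 := (hL s (by linarith)).mul_left (exp ((s - t) * N₁))
  have h2 := (hL s' hs').mul_left (exp (-(t - s') * N₂))
  have h3 : HasSum (fun j => if j ∈ Finset.range M then p n * exp (-t * N₁) else 0)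
      (M * (p n * exp (-t * N₁))) := by
    have := hasSum_sum_of_ne_finset_zero (L := .unconditional ℕ) (s := Finset.range M)
      (f := fun j => if j ∈ Finset.range M then p n * exp (-t * N₁) else 0)
      (fun j hj => if_neg hj)
    rwa [Finset.sum_ite_mem, Finset.inter_self, Finset.sum_const, Finset.card_range,
      nsmul_eq_mul] at this
  refine hasSum_le (fun j => ?_) (hL t (by linarith)) ((h1.add h2).add h3)
  have hpj := hp j
  have hpn := hp n
  have n1 : 0 ≤ exp ((s - t) * N₁) * (p j * exp (-s * j)) := by positivity
  have n2 : 0 ≤ exp (-(t - s') * N₂) * (p j * exp (-s' * j)) := by positivity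
  have n3 : 0 ≤ if j ∈ Finset.range M then p n * exp (-t * N₁) else 0 := by
    split_ifs <;> positivity
  rcases lt_or_ge j M with hjM | hjM
  · rcases le_total (j : ℝ) N₁ with hj | hj
    · have : p j * exp (-t * j) ≤ exp ((s - t) * N₁) * (p j * exp (-s * j)) := by
        rw [mul_left_comm, ← exp_add]
        gcongr
        nlinarith [mul_le_mul_of_nonneg_left hj (sub_nonneg.2 hts)]
      linarith
    · have : p j * exp (-t * j) ≤ p n * exp (-t * N₁) := by
        have := hmono j n (by omega)
        have ht : 0 ≤ t := by linarith
        have := mul_le_mul_of_nonneg_left hj ht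
        gcongr ?_ * exp ?_
        linarith
      rw [if_pos (Finset.mem_range.2 hjM)] at n3 ⊢
      linarith
  · have hj : N₂ ≤ j := hN₂.trans (by exact_mod_cast hjM)
    have : p j * exp (-t * j) ≤ exp (-(t - s') * N₂) * (p j * exp (-s' * j)) := by
      rw [mul_left_comm, ← exp_add]
      gcongr
      nlinarith [mul_le_mul_of_nonneg_left hj (sub_nonneg.2 hs't)]
    linarith

theorem tendsto_div_sqrt_nhdsGT_zero {τ : ℝ} (hτ : 0 < τ) :
    Tendsto (fun n : ℕ => τ / √(n : ℝ)) atTop (nhdsWithin 0 (Set.Ioi 0)) := by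
  refine tendsto_nhdsWithin_iff.2 ⟨?_, ?_⟩
  · exact (tendsto_sqrt_atTop.comp tendsto_natCast_atTop_atTop).const_div_atTop τ
  · filter_upwards [eventually_gt_atTop 0] with n hn
    exact div_pos hτ (sqrt_pos.2 (by exact_mod_cast hn))

theorem tendsto_log_div_sqrt_atTop :
    Tendsto (fun n : ℕ => log n / √(n : ℝ)) atTop (nhds 0) := by
  have h := (isLittleO_log_rpow_atTop (show (0 : ℝ) < 1 / 2 by norm_num)).tendsto_div_nhds_zero
  simp_rw [← sqrt_eq_rpow] at h
  exact h.comp tendsto_natCast_atTop_atTop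

theorem tendsto_mul_log_comp_const_mul {L : ℝ → ℝ} {C : ℝ}
    (hlim : Tendsto (fun t => t * log (L t)) (nhdsWithin 0 (Set.Ioi 0)) (nhds C)) {b : ℝ}
    (hb : 0 < b) :
    Tendsto (fun t => t * log (L (b * t))) (nhdsWithin 0 (Set.Ioi 0)) (nhds (C / b)) := by
  have hlin : Tendsto (fun t : ℝ => b * t) (nhdsWithin 0 (Set.Ioi 0))
      (nhdsWithin 0 (Set.Ioi 0)) := by
    refine tendsto_nhdsWithin_iff.2 ⟨?_, ?_⟩
    · have : Continuous fun t : ℝ => b * t := by fun_prop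
      simpa using (this.tendsto 0).mono_left nhdsWithin_le_nhds
    · filter_upwards [self_mem_nhdsWithin] with t ht
      exact mul_pos hb ht
  refine ((hlim.comp hlin).div_const b).congr fun t => ?_
  simp only [Function.comp]
  field_simp

theorem log_div_sqrt_lower_bound {p : ℕ → ℝ} (hp : ∀ n, 0 ≤ p n) {L : ℝ → ℝ}
    (hL : ∀ t > 0, HasSum (fun n => p n * exp (-t * n)) (L t)) {k₀ : ℕ}
    (hmono : ∀ j n, j + k₀ ≤ n → p j ≤ p n) {C : ℝ} (hC : 0 < C)
    (hlim : Tendsto (fun t => t * log (L t)) (nhdsWithin 0 (Set.Ioi 0)) (nhds C))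
    (hLpos : ∀ t > 0, 0 < L t) {η : ℝ} (hη : 0 < η) (hη' : η < 1 / 4) {c : ℝ}
    (hc : c < (C + (1 - 4 * η) * C) / √((1 + 8 * η) * C)) :
    ∀ᶠ n : ℕ in atTop, c < log (p n) / √(n : ℝ) := by
  set τ := √((1 + 8 * η) * C) with hτdef
  have hτ2 : τ ^ 2 = (1 + 8 * η) * C := sq_sqrt (by positivity)
  have hτ : 0 < τ := sqrt_pos.2 (by positivity)
  have hid : Tendsto (fun t : ℝ => t * t⁻¹) (nhdsWithin 0 (Set.Ioi 0)) (nhds 1) := by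
    refine tendsto_const_nhds.congr' ?_
    filter_upwards [self_mem_nhdsWithin] with t ht
    exact (mul_inv_cancel₀ (ne_of_gt ht)).symm
  have hT1 : ∀ᶠ t in nhdsWithin 0 (Set.Ioi 0),
      exp (η * (1 - 4 * η) * C * t⁻¹ + log (L ((1 + η) * t))) ≤ exp (log (L t)) / 4 := by
    refine eventually_exp_le_quarter_exp
      (α := η * (1 - 4 * η) * C * 1 + C / (1 + η)) ?_ ?_ hlim
    · have : C / (1 + η) ≤ C * (1 - η + η ^ 2) := by
        rw [div_le_iff₀ (by positivity)]
        have : 0 ≤ C * η ^ 3 := by positivity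
        nlinarith
      have : 0 < C * η ^ 2 := by positivity
      nlinarith
    · refine ((hid.const_mul (η * (1 - 4 * η) * C)).add
        (tendsto_mul_log_comp_const_mul hlim (by positivity : 0 < 1 + η))).congr fun t => ?_
      ring
  have hT2 : ∀ᶠ t in nhdsWithin 0 (Set.Ioi 0),
      exp (-(η * (1 + 4 * η) * C) * t⁻¹ + log (L ((1 - η) * t))) ≤ exp (log (L t)) / 4 := by
    refine eventually_exp_le_quarter_exp
      (α := -(η * (1 + 4 * η) * C) * 1 + C / (1 - η)) ?_ ?_ hlim
    · have : C / (1 - η) ≤ C * (1 + η + 2 * η ^ 2) := by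
        rw [div_le_iff₀ (by linarith)]
        have : 0 ≤ C * η ^ 2 * (1 - 2 * η) :=
          mul_nonneg (by positivity) (by linarith)
        nlinarith
      have : 0 < C * η ^ 2 := by positivity
      nlinarith
    · refine ((hid.const_mul (-(η * (1 + 4 * η) * C))).add
        (tendsto_mul_log_comp_const_mul hlim (by linarith : 0 < 1 - η))).congr fun t => ?_
      ring
  have htn := tendsto_div_sqrt_nhdsGT_zero hτ
  have hlow : Tendsto (fun n : ℕ =>
      (τ / √(n : ℝ) * log (L (τ / √(n : ℝ))) + (1 - 4 * η) * C) / τ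
        - log 2 / √(n : ℝ) - log n / √(n : ℝ)) atTop
      (nhds ((C + (1 - 4 * η) * C) / τ - 0 - 0)) :=
    ((((hlim.comp htn).add_const _).div_const τ).sub
      ((tendsto_sqrt_atTop.comp tendsto_natCast_atTop_atTop).const_div_atTop _)).sub
      tendsto_log_div_sqrt_atTop
  rw [sub_zero, sub_zero] at hlow
  have hbig : ∀ᶠ n : ℕ in atTop, (k₀ : ℝ) * (1 + 8 * η) / (4 * η) ≤ n :=
    tendsto_natCast_atTop_atTop.eventually_ge_atTop _
  filter_upwards [hlow.eventually_const_lt hc, htn.eventually hT1, htn.eventually hT2, hbig,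
    eventually_gt_atTop k₀] with n hn h1 h2 hk hnk
  refine hn.trans_le ?_
  have hn0 : (0 : ℝ) < n := by exact_mod_cast (Nat.zero_le _).trans_lt hnk
  have hsq : 0 < √(n : ℝ) := sqrt_pos.2 hn0
  set t := τ / √(n : ℝ) with htdef
  have ht : 0 < t := div_pos hτ hsq
  have ht2 : t ^ 2 * n = (1 + 8 * η) * C := by
    rw [htdef, div_pow, sq_sqrt hn0.le, hτ2]
    field_simp
  have hkn : k₀ ≤ n := hnk.le
  have hN₂ : (1 + 4 * η) * C / t ^ 2 ≤ ((n - k₀ : ℕ) : ℝ) := by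
    rw [Nat.cast_sub hkn]
    rw [div_le_iff₀ (by positivity)] at hk ⊢
    have h3 : C = t ^ 2 * n / (1 + 8 * η) := by rw [ht2]; field_simp
    rw [h3, mul_div_assoc', div_le_iff₀ (by positivity)]
    have := mul_le_mul_of_nonneg_left hk (sq_nonneg t)
    nlinarith
  have hsplit := laplace_le_tails_add_middle hp hL hmono (s := (1 + η) * t) (t := t)
    (s' := (1 - η) * t) (N₁ := (1 - 4 * η) * C / t ^ 2) (N₂ := (1 + 4 * η) * C / t ^ 2)
    (M := n - k₀) (n := n) (mul_pos (by linarith) ht) (by nlinarith) (by nlinarith) hN₂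
    (by omega)
  have e1 : ((1 + η) * t - t) * ((1 - 4 * η) * C / t ^ 2) = η * (1 - 4 * η) * C * t⁻¹ := by
    field_simp; ring
  have e2 : -(t - (1 - η) * t) * ((1 + 4 * η) * C / t ^ 2) =
      -(η * (1 + 4 * η) * C) * t⁻¹ := by
    field_simp; ring
  have e3 : -t * ((1 - 4 * η) * C / t ^ 2) = -((1 - 4 * η) * C / t) := by
    field_simp
  rw [exp_add, exp_log (hLpos _ (by positivity)), exp_log (hLpos t ht)] at h1
  rw [exp_add, exp_log (hLpos _ (mul_pos (by linarith) ht)), exp_log (hLpos t ht)] at h2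
  rw [e1, e2, e3] at hsplit
  have hpn := hp n
  have hhalf : L t / 2 ≤ n * (p n * exp (-((1 - 4 * η) * C / t))) := by
    have : ((n - k₀ : ℕ) : ℝ) * (p n * exp (-((1 - 4 * η) * C / t))) ≤
        n * (p n * exp (-((1 - 4 * η) * C / t))) := by
      gcongr
      omega
    linarith
  have hppos : 0 < p n := by
    refine hpn.lt_of_ne fun h => ?_
    rw [← h, zero_mul, mul_zero] at hhalf
    linarith [hLpos t ht]
  have hlog := log_le_log (half_pos (hLpos t ht)) hhalf
  rw [log_div (hLpos t ht).ne' two_ne_zero, log_mul hn0.ne' (by positivity),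
    log_mul hppos.ne' (exp_pos _).ne', log_exp] at hlog
  have hfinal : (t * log (L t) + (1 - 4 * η) * C) / τ - log 2 / √(n : ℝ) - log n / √(n : ℝ) =
      (log (L t) + (1 - 4 * η) * C / t - log 2 - log n) / √(n : ℝ) := by
    have : √(n : ℝ) = τ / t := by rw [htdef]; field_simp
    rw [this]
    field_simp
  rw [hfinal]
  gcongr
  linarith

/-- Tauberian theorem for almost monotone coefficients: the growth `log L(t) ~ C / t` of the Laplace
sum determines the logarithmic growth of its coefficients. -/
theorem tendsto_log_div_sqrt_of_laplace {p : ℕ → ℝ} (hp : ∀ n, 0 ≤ p n) (hp0 : 0 < p 0)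
    {L : ℝ → ℝ} (hL : ∀ t > 0, HasSum (fun n => p n * exp (-t * n)) (L t)) {k₀ : ℕ}
    (hmono : ∀ j n, j + k₀ ≤ n → p j ≤ p n) {C : ℝ} (hC : 0 < C)
    (hlim : Tendsto (fun t => t * log (L t)) (nhdsWithin 0 (Set.Ioi 0)) (nhds C)) :
    Tendsto (fun n : ℕ => log (p n) / √(n : ℝ)) atTop (nhds (2 * √C)) := by
  have hterm : ∀ t > 0, ∀ n, p n * exp (-t * n) ≤ L t := fun t ht n =>
    le_hasSum (hL t ht) n fun j _ => mul_nonneg (hp j) (exp_pos _).le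
  have hLpos : ∀ t > 0, 0 < L t := fun t ht =>
    lt_of_lt_of_le (by positivity) (hterm t ht 0)
  have hsC : 0 < √C := sqrt_pos.2 hC
  rw [tendsto_order]
  constructor
  · intro c hc
    have hcont : Tendsto (fun η : ℝ => (C + (1 - 4 * η) * C) / √((1 + 8 * η) * C))
        (nhdsWithin 0 (Set.Ioi 0)) (nhds (2 * √C)) := by
      have h : ContinuousAt (fun η : ℝ => (C + (1 - 4 * η) * C) / √((1 + 8 * η) * C)) 0 := by
        refine ContinuousAt.div (by fun_prop) (by fun_prop) ?_
        simpa using hsC.ne'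
      have h0 : (C + (1 - 4 * (0 : ℝ)) * C) / √((1 + 8 * 0) * C) = 2 * √C := by
        simp only [mul_zero, sub_zero, add_zero, one_mul]
        rw [div_eq_iff hsC.ne', mul_assoc, mul_self_sqrt hC.le]
        ring
      rw [← h0]
      exact h.tendsto.mono_left nhdsWithin_le_nhds
    obtain ⟨η, ⟨hη, hη'⟩, hη0⟩ := ((hcont.eventually_const_lt hc).and
      (((eventually_lt_nhds (show (0 : ℝ) < 1 / 4 by norm_num)).filter_mono
        nhdsWithin_le_nhds))).and self_mem_nhdsWithin |>.exists
    exact log_div_sqrt_lower_bound hp hL hmono hC hlim hLpos hη0 hη' hη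
  · intro c hc
    have htn := tendsto_div_sqrt_nhdsGT_zero hsC
    have hup : Tendsto (fun n : ℕ => √C / √(n : ℝ) * log (L (√C / √(n : ℝ))) / √C + √C) atTop
        (nhds (C / √C + √C)) := ((hlim.comp htn).div_const _).add_const _
    have hval : C / √C + √C = 2 * √C := by
      rw [div_sqrt]; ring
    rw [hval] at hup
    filter_upwards [hup.eventually_lt_const hc, eventually_gt_atTop 0, eventually_ge_atTop k₀]
      with n hn hn0 hnk
    refine lt_of_le_of_lt ?_ hn
    have hn0' : (0 : ℝ) < n := by exact_mod_cast hn0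
    have hsq : 0 < √(n : ℝ) := sqrt_pos.2 hn0'
    set t := √C / √(n : ℝ) with htdef
    have ht : 0 < t := div_pos hsC hsq
    have hpn : 0 < p n := hp0.trans_le (hmono 0 n (by omega))
    have hlog := log_le_log (by positivity) (hterm t ht n)
    rw [log_mul hpn.ne' (exp_pos _).ne', log_exp] at hlog
    have hfinal : t * log (L t) / √C + √C = (log (L t) + t * n) / √(n : ℝ) := by
      have hnn : (n : ℝ) = √(n : ℝ) * √(n : ℝ) := (mul_self_sqrt hn0'.le).symm
      rw [add_div, htdef]
      congr 1
      · field_simp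
      · nth_rewrite 2 [hnn]
        field_simp
    rw [hfinal]
    gcongr
    linarith

theorem setGcd_residue_classes_eq_one {m ℓ : ℕ} {r : Fin ℓ → ℕ} (hℓ : 0 < ℓ)
    (hr1 : ∀ i, 1 ≤ r i) (hgcd : Nat.gcd (Finset.univ.gcd r) m = 1) :
    Nat.setGcd {a : ℕ | 0 < a ∧ ∃ i, a ≡ r i [MOD m]} = 1 := by
  set d := Nat.setGcd {a : ℕ | 0 < a ∧ ∃ i, a ≡ r i [MOD m]}
  have hr : ∀ i, d ∣ r i := fun i => Nat.setGcd_dvd_of_mem ⟨hr1 i, i, Nat.ModEq.refl _⟩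
  have hrm : d ∣ r ⟨0, hℓ⟩ + m := Nat.setGcd_dvd_of_mem
    ⟨Nat.add_pos_left (hr1 _) m, ⟨0, hℓ⟩, by simp [Nat.ModEq]⟩
  have hm : d ∣ m := (Nat.dvd_add_right (hr _)).1 hrm
  have := Nat.dvd_gcd (Finset.dvd_gcd (s := Finset.univ) fun i _ => hr i) hm
  rw [hgcd] at this
  exact Nat.dvd_one.1 this

theorem injective_add_mul_of_strictMono {m ℓ : ℕ} {r : Fin ℓ → ℕ}
    (hmono : StrictMono r) (hr1 : ∀ i, 1 ≤ r i) (hrm : ∀ i, r i ≤ m) :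
    Function.Injective fun q : Fin ℓ × ℕ => r q.1 + m * q.2 := by
  rintro ⟨i, k⟩ ⟨j, l⟩ h
  simp only at h
  have hi := hr1 i
  have hj := hr1 j
  have hi' := hrm i
  have hj' := hrm j
  have hkl : k = l := by
    rcases lt_trichotomy k l with hlt | heq | hlt
    · nlinarith
    · exact heq
    · nlinarith
  subst hkl
  rw [hmono.injective (Nat.add_right_cancel h)]

theorem range_add_mul_eq {m ℓ : ℕ} {r : Fin ℓ → ℕ} (hr1 : ∀ i, 1 ≤ r i) (hrm : ∀ i, r i ≤ m) :
    Set.range (fun q : Fin ℓ × ℕ => r q.1 + m * q.2) =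
      {a : ℕ | 0 < a ∧ ∃ i, a ≡ r i [MOD m]} := by
  ext a
  constructor
  · rintro ⟨⟨i, k⟩, rfl⟩
    exact ⟨Nat.add_pos_left (hr1 i) _, i, by simp [Nat.ModEq]⟩
  · rintro ⟨ha, i, hi⟩
    have hle : r i ≤ a := by
      rcases (hrm i).lt_or_eq with hlt | heq
      · rw [Nat.ModEq, Nat.mod_eq_of_lt hlt] at hi
        exact hi ▸ Nat.mod_le a m
      · rw [heq] at hi ⊢
        exact Nat.le_of_dvd ha ((Nat.modEq_zero_iff_dvd).1 (hi.trans (by simp [Nat.ModEq])))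
    obtain ⟨k, hk⟩ := (Nat.modEq_iff_dvd' hle).1 hi.symm
    exact ⟨(i, k), by simp only; omega⟩

theorem hasSum_indicator_residue_classes {m ℓ : ℕ} (hm : 0 < m) {r : Fin ℓ → ℕ}
    (hmono : StrictMono r) (hr1 : ∀ i, 1 ≤ r i) (hrm : ∀ i, r i ≤ m) {t : ℝ} (ht : 0 < t) :
    HasSum ({a : ℕ | 0 < a ∧ ∃ i, a ≡ r i [MOD m]}.indicator
      fun a => -log (1 - exp (-t) ^ a)) (∑ i, logProdSeries (r i) m t) := by
  rw [← range_add_mul_eq hr1 hrm,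
    ← (injective_add_mul_of_strictMono hmono hr1 hrm).hasSum_iff
      (fun a ha => Set.indicator_of_notMem ha _)]
  have hfib : ∀ i : Fin ℓ, HasSum (fun k : ℕ => -log (1 - exp (-t) ^ (r i + m * k)))
      (logProdSeries (r i) m t) := by
    intro i
    convert hasSum_neg_log_one_sub_exp (r := r i) (m := m) (by exact_mod_cast hr1 i)
      (by exact_mod_cast hm) ht using 5 with k
    rw [← exp_nat_mul]
    congr 1
    push_cast
    ring
  have hcomp : (Set.range fun q : Fin ℓ × ℕ => r q.1 + m * q.2).indicator
      (fun a => -log (1 - exp (-t) ^ a)) ∘ (fun q : Fin ℓ × ℕ => r q.1 + m * q.2) =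
      fun q => -log (1 - exp (-t) ^ (r q.1 + m * q.2)) := by
    funext q
    exact Set.indicator_of_mem (Set.mem_range_self q) _
  rw [hcomp]
  have hs : Summable fun q : Fin ℓ × ℕ => -log (1 - exp (-t) ^ (r q.1 + m * q.2)) := by
    rw [summable_prod_of_nonneg fun q => ?_]
    · exact ⟨fun i => (hfib i).summable, (hasSum_fintype _).summable⟩
    · exact neg_nonneg.2 (log_nonpos
        (sub_nonneg.2 (pow_le_one₀ (exp_pos _).le (exp_le_one_iff.2 (by linarith))))
        (sub_le_self _ (by positivity)))
  have := (hs.hasSum.prod_fiberwise hfib).unique (hasSum_fintype _)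
  rw [← this]
  exact hs.hasSum

theorem stmt_0 (m ℓ : ℕ) (hm : 0 < m) (hℓ : 0 < ℓ) (r : Fin ℓ → ℕ)
    (hmono : StrictMono r) (hr1 : ∀ i, 1 ≤ r i) (hrm : ∀ i, r i ≤ m)
    (hgcd : Nat.gcd (Finset.univ.gcd r) m = 1)
    (A : Set ℕ) (hA : A = {a : ℕ | 0 < a ∧ ∃ i, a ≡ r i [MOD m]}) :
    Tendsto
      (fun n : ℕ =>
        Real.log (partCount A n) / (π * Real.sqrt (2 * ℓ * n / (3 * m))))
      atTop (nhds 1) := by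
  have hApos : ∀ a ∈ A, 0 < a := fun a ha => by
    rw [hA] at ha
    exact ha.1
  have hmR : (0 : ℝ) < m := by exact_mod_cast hm
  have hℓR : (0 : ℝ) < ℓ := by exact_mod_cast hℓ
  obtain ⟨k₀, hk₀⟩ := Nat.exists_mem_closure_of_ge A
  have hmon : ∀ j n, j + k₀ ≤ n → (partCount A j : ℝ) ≤ partCount A n := by
    intro j n hjn
    have hmem : n - j ∈ AddSubmonoid.closure A := hk₀ (n - j) (by omega) (by
      rw [hA, setGcd_residue_classes_eq_one hℓ hr1 hgcd]
      exact one_dvd _)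
    have h := partCount_le_partCount_add_of_mem_closure hApos hmem j
    rw [Nat.add_sub_cancel' (by omega)] at h
    exact_mod_cast h
  have hL : ∀ t > 0, HasSum (fun n : ℕ => (partCount A n : ℝ) * exp (-t * n))
      (exp (∑ i, logProdSeries (r i) m t)) := by
    intro t ht
    have h := hasSum_partCount (A := A) (fun h0 => (hApos 0 h0).ne' rfl) (exp_pos (-t)).le
      (exp_lt_one_iff.2 (by linarith))
      (by rw [hA]; exact hasSum_indicator_residue_classes hm hmono hr1 hrm ht)
    convert h using 3 with n
    rw [← exp_nat_mul, mul_comm]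
  have hlim : Tendsto (fun t => t * log (exp (∑ i, logProdSeries (r i) m t)))
      (nhdsWithin 0 (Set.Ioi 0)) (nhds (ℓ * (π ^ 2 / 6 / m))) := by
    simp_rw [log_exp, Finset.mul_sum]
    have h := tendsto_finsetSum (Finset.univ : Finset (Fin ℓ)) fun i _ =>
      tendsto_mul_logProdSeries (r := r i) (m := m) (by exact_mod_cast hr1 i)
        (by exact_mod_cast hm)
    simpa using h
  have hC : 0 < ℓ * (π ^ 2 / 6 / m) := by positivity
  have h := tendsto_log_div_sqrt_of_laplace (p := fun n => (partCount A n : ℝ))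
    (fun n => Nat.cast_nonneg _) (by simp [partCount_zero]) hL hmon hC hlim
  have h' := h.div_const (2 * √(ℓ * (π ^ 2 / 6 / m)))
  rw [div_self (by positivity)] at h'
  refine h'.congr fun n => ?_
  rw [div_div]
  congr 1
  have e : 2 * ℓ * n / (3 * m) = (2 / π) ^ 2 * (n * (ℓ * (π ^ 2 / 6 / m))) := by
    field_simp
    ring
  rw [e, sqrt_mul (by positivity) ((n : ℝ) * _), sqrt_sq (by positivity),
    sqrt_mul (Nat.cast_nonneg n)]
  field_simp
end

section
/- Let m, ℓ, r_1, …, r_ℓ be positive integers with 1 ≤ r_1 < r_2 < ⋯ < r_ℓ ≤ m. Let A be the set of all positive integers a such that a ≡ r_i (mod m) for some i ∈ {1, …, ℓ}, and let p_A(n) denote the number of partitions of n into parts belonging to A. Then limsup_{n→∞} (log p_A(n)) / (π√(2ℓn/(3m))) ≤ 1. -/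
open Filter Real

/-- Rankin's bound: a single coefficient of the generating product of partitions with parts in `A`
is at most the value of the product. -/
lemma partCount_mul_pow_le_prod (A : Set ℕ) (n : ℕ) (F : Finset ℕ)
    (hF : ∀ a ∈ A, 0 < a → a ≤ n → a ∈ F) (hpos : ∀ a ∈ F, 0 < a)
    {x : ℝ} (hx0 : 0 ≤ x) (hx1 : x < 1) :
    partCount A n * x ^ n ≤ ∏ a ∈ F, (1 - x ^ a)⁻¹ := by
  classical
  let P := {p : n.Partition // ∀ i ∈ p.parts, i ∈ A}
  let φ : P → (F → ℕ) := fun p a => p.1.parts.count (a : ℕ)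
  have hmem : ∀ p : P, ∀ a ∈ p.1.parts, a ∈ F := fun p a ha =>
    hF a (p.2 a ha) (p.1.parts_pos ha)
      (by simpa [p.1.parts_sum] using Multiset.le_sum_of_mem ha)
  have hinj : Function.Injective φ := by
    intro p q h
    apply Subtype.ext
    apply Nat.Partition.ext
    ext a
    by_cases ha : a ∈ F
    · exact congrFun h ⟨a, ha⟩
    · rw [Multiset.count_eq_zero_of_notMem fun h => ha (hmem p a h),
        Multiset.count_eq_zero_of_notMem fun h => ha (hmem q a h)]
  have hsum : ∀ p : P, ∑ a : F, (a : ℕ) * φ p a = n := by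
    intro p
    rw [Finset.sum_coe_sort F fun a => a * p.1.parts.count a]
    conv_rhs => rw [← p.1.parts_sum]
    rw [Finset.sum_multiset_count_of_subset p.1.parts F fun a ha =>
      hmem p a (Multiset.mem_toFinset.1 ha)]
    simp [mul_comm]
  have hbd : ∀ p : P, φ p ∈ Fintype.piFinset fun _ : F => Finset.range (n + 1) := by
    intro p
    rw [Fintype.mem_piFinset]
    intro a
    have h1 := Finset.single_le_sum (f := fun a : F => (a : ℕ) * φ p a)
      (fun _ _ => Nat.zero_le _) (Finset.mem_univ a)
    rw [hsum] at h1
    have h2 := Nat.le_mul_of_pos_left (φ p a) (hpos a a.2)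
    simp only [Finset.mem_range]
    lia
  calc (partCount A n : ℝ) * x ^ n = ∑ p : P, ∏ a : F, (x ^ (a : ℕ)) ^ φ p a := by
        have : ∀ p : P, ∏ a : F, (x ^ (a : ℕ)) ^ φ p a = x ^ n := by
          intro p
          simp_rw [← pow_mul]
          rw [Finset.prod_pow_eq_pow_sum, hsum]
        rw [Finset.sum_congr rfl fun p _ => this p]
        simp [partCount, P]
    _ = ∑ f ∈ Finset.univ.image φ, ∏ a : F, (x ^ (a : ℕ)) ^ f a := by
        rw [Finset.sum_image fun p _ q _ h => hinj h]
    _ ≤ ∑ f ∈ Fintype.piFinset fun _ : F => Finset.range (n + 1),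
          ∏ a : F, (x ^ (a : ℕ)) ^ f a := by
        apply Finset.sum_le_sum_of_subset_of_nonneg
        · intro f hf
          obtain ⟨p, -, rfl⟩ := Finset.mem_image.1 hf
          exact hbd p
        · intros
          positivity
    _ = ∏ a : F, ∑ j ∈ Finset.range (n + 1), (x ^ (a : ℕ)) ^ j := by
        rw [Finset.prod_univ_sum]
    _ ≤ ∏ a : F, (1 - x ^ (a : ℕ))⁻¹ := by
        apply Finset.prod_le_prod
        · intros
          positivity
        · intro a _
          have h1 : x ^ (a : ℕ) < 1 := pow_lt_one₀ hx0 hx1 (hpos a a.2).ne'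
          rw [← tsum_geometric_of_lt_one (by positivity) h1]
          exact (summable_geometric_of_lt_one (by positivity) h1).sum_le_tsum _
            fun _ _ => by positivity
    _ = ∏ a ∈ F, (1 - x ^ a)⁻¹ := Finset.prod_coe_sort F fun a => (1 - x ^ a)⁻¹

lemma inv_one_sub_exp_neg_le {y : ℝ} (hy : 0 < y) : (1 - exp (-y))⁻¹ ≤ 1 / y + 1 := by
  have h1 : exp (-y) ≤ (1 + y)⁻¹ := by
    rw [exp_neg]
    gcongr
    linarith [add_one_le_exp y]
  have h2 : y / (1 + y) ≤ 1 - exp (-y) := by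
    have : y / (1 + y) = 1 - (1 + y)⁻¹ := by field_simp; ring
    linarith
  calc (1 - exp (-y))⁻¹ ≤ (y / (1 + y))⁻¹ := by gcongr
    _ = 1 / y + 1 := by field_simp

/-- The exponential sum over one residue class, compared with an integral. -/
lemma sum_exp_arith_prog_le {m r : ℕ} (hm : 0 < m) (hr : 1 ≤ r) (N : ℕ) {s : ℝ} (hs : 0 < s) :
    ∑ j ∈ Finset.range N, exp (-s) ^ (r + j * m) ≤ 1 / (s * m) + exp (-s) := by
  have hm' : (0 : ℝ) < m := by exact_mod_cast hm
  have hx1 : exp (-s) < 1 := exp_lt_one_iff.2 (by linarith)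
  have hx0 := exp_pos (-s)
  have hxm : exp (-s) ^ m = exp (-(s * m)) := by rw [← exp_nat_mul]; ring_nf
  have hlt : exp (-s) ^ m < 1 := pow_lt_one₀ hx0.le hx1 hm.ne'
  have hgeom : ∑ j ∈ Finset.range N, (exp (-s) ^ m) ^ j ≤ 1 / (s * m) + 1 := by
    refine le_trans ?_ (inv_one_sub_exp_neg_le (mul_pos hs hm'))
    rw [← hxm, ← tsum_geometric_of_lt_one (by positivity) hlt]
    exact (summable_geometric_of_lt_one (by positivity) hlt).sum_le_tsum _
      fun _ _ => by positivity
  have hr' : exp (-s) ^ r ≤ exp (-s) := pow_le_of_le_one hx0.le hx1.le (by lia)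
  calc ∑ j ∈ Finset.range N, exp (-s) ^ (r + j * m)
      = exp (-s) ^ r * ∑ j ∈ Finset.range N, (exp (-s) ^ m) ^ j := by
        rw [Finset.mul_sum]
        refine Finset.sum_congr rfl fun j _ => ?_
        rw [pow_add, mul_comm j m, pow_mul]
    _ ≤ exp (-s) * (1 / (s * m) + 1) := by gcongr
    _ = exp (-s) * (1 / (s * m)) + exp (-s) := by ring
    _ ≤ 1 / (s * m) + exp (-s) := by
        gcongr
        exact mul_le_of_le_one_left (by positivity) hx1.le

/-- The logarithm of the generating product over `F`, given a bound for its exponential sums. -/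
lemma sum_neg_log_one_sub_exp_le (F : Finset ℕ) (hpos : ∀ a ∈ F, 0 < a) {m ℓ : ℕ} (hm : 0 < m)
    (hF : ∀ s : ℝ, 0 < s → ∑ a ∈ F, exp (-s) ^ a ≤ ℓ * (1 / (s * m) + exp (-s)))
    {t : ℝ} (ht : 0 < t) :
    ∑ a ∈ F, -log (1 - exp (-t) ^ a) ≤
      ℓ * (π ^ 2 / (6 * m * t) - log (1 - exp (-t))) := by
  have hx1 : exp (-t) < 1 := exp_lt_one_iff.2 (by linarith)
  have hx0 := exp_pos (-t)
  have hm' : (0 : ℝ) < m := by exact_mod_cast hm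
  have habs : ∀ a : ℕ, 0 < a → |exp (-t) ^ a| < 1 := fun a ha => by
    rw [abs_of_nonneg (by positivity)]
    exact pow_lt_one₀ hx0.le hx1 ha.ne'
  have hleft : HasSum (fun k : ℕ => ∑ a ∈ F, (exp (-t) ^ a) ^ (k + 1) / (k + 1))
      (∑ a ∈ F, -log (1 - exp (-t) ^ a)) :=
    hasSum_sum fun a ha => hasSum_pow_div_log_of_abs_lt_one (habs a (hpos a ha))
  have hlog : HasSum (fun k : ℕ => exp (-t) ^ (k + 1) / ((k : ℝ) + 1)) (-log (1 - exp (-t))) :=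
    hasSum_pow_div_log_of_abs_lt_one (by simpa using habs 1 one_pos)
  have hzeta : HasSum (fun k : ℕ => 1 / ((k : ℝ) + 1) ^ 2) (π ^ 2 / 6) := by
    have := (hasSum_nat_add_iff' 1).2 hasSum_zeta_two
    simpa using this
  have hright := ((hzeta.mul_left (1 / (m * t))).add hlog).mul_left (ℓ : ℝ)
  have hval : (ℓ : ℝ) * (π ^ 2 / (6 * m * t) - log (1 - exp (-t))) =
      ℓ * (1 / (m * t) * (π ^ 2 / 6) + -log (1 - exp (-t))) := by
    field_simp
    ring
  rw [hval]
  refine hasSum_le (fun k => ?_) hleft hright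
  have hk : (0 : ℝ) < (k : ℝ) + 1 := by positivity
  have hexp : exp (-t) ^ (k + 1) = exp (-(t * (k + 1))) := by
    rw [← exp_nat_mul]
    push_cast
    ring_nf
  have := hF (t * (k + 1)) (by positivity)
  calc ∑ a ∈ F, (exp (-t) ^ a) ^ (k + 1) / ((k : ℝ) + 1)
      = (∑ a ∈ F, exp (-(t * (k + 1))) ^ a) / (k + 1) := by
        rw [Finset.sum_div, ← hexp]
        simp_rw [← pow_mul, mul_comm]
    _ ≤ (ℓ * (1 / (t * (k + 1) * m) + exp (-(t * (k + 1))))) / (k + 1) := by gcongr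
    _ = _ := by
        rw [hexp]
        field_simp

lemma log_partCount_le {m ℓ : ℕ} (hm : 0 < m) (r : Fin ℓ → ℕ)
    (hr1 : ∀ i, 1 ≤ r i) (hrm : ∀ i, r i ≤ m) (n : ℕ) {t : ℝ} (ht : 0 < t) :
    log (partCount {a : ℕ | 0 < a ∧ ∃ i, a ≡ r i [MOD m]} n) ≤
      t * n + ℓ * (π ^ 2 / (6 * m * t) + log (1 / t + 1)) := by
  classical
  set A := {a : ℕ | 0 < a ∧ ∃ i, a ≡ r i [MOD m]}
  have hx1 : exp (-t) < 1 := exp_lt_one_iff.2 (by linarith)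
  have hx0 := exp_pos (-t)
  let ψ : Fin ℓ × ℕ → ℕ := fun q => r q.1 + q.2 * m
  let I : Finset (Fin ℓ × ℕ) := Finset.univ ×ˢ Finset.range (n + 1)
  have hpos : ∀ a ∈ I.image ψ, 0 < a := by
    intro a ha
    obtain ⟨q, -, rfl⟩ := Finset.mem_image.1 ha
    exact Nat.add_pos_left (hr1 q.1) _
  have hmem : ∀ a ∈ A, 0 < a → a ≤ n → a ∈ I.image ψ := by
    rintro a ⟨ha, i, hi⟩ - han
    have hle : r i ≤ a := by
      by_contra! hlt
      have h1 := Nat.le_of_dvd (by lia) ((Nat.modEq_iff_dvd' hlt.le).1 hi)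
      have := hrm i
      lia
    obtain ⟨j, hj⟩ := (Nat.modEq_iff_dvd' hle).1 hi.symm
    have hjm : j ≤ m * j := Nat.le_mul_of_pos_left j hm
    refine Finset.mem_image.2 ⟨(i, j), ?_, ?_⟩
    · simp only [I, Finset.mem_product, Finset.mem_univ, Finset.mem_range, true_and]
      lia
    · simp only [ψ]
      rw [mul_comm j m]
      lia
  have hexp : ∀ s : ℝ, 0 < s →
      ∑ a ∈ I.image ψ, exp (-s) ^ a ≤ ℓ * (1 / (s * m) + exp (-s)) := by
    intro s hs
    calc ∑ a ∈ I.image ψ, exp (-s) ^ a ≤ ∑ q ∈ I, exp (-s) ^ ψ q :=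
          Finset.sum_image_le_of_nonneg fun _ _ => by positivity
      _ = ∑ i : Fin ℓ, ∑ j ∈ Finset.range (n + 1), exp (-s) ^ (r i + j * m) := by
          rw [Finset.sum_product]
      _ ≤ ∑ _i : Fin ℓ, (1 / (s * m) + exp (-s)) :=
          Finset.sum_le_sum fun i _ => sum_exp_arith_prog_le hm (hr1 i) _ hs
      _ = ℓ * (1 / (s * m) + exp (-s)) := by simp [mul_add]
  have hfac : ∀ a ∈ I.image ψ, 0 < 1 - exp (-t) ^ a := fun a ha =>
    sub_pos.2 (pow_lt_one₀ hx0.le hx1 (hpos a ha).ne')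
  have hlog_inv : -log (1 - exp (-t)) ≤ log (1 / t + 1) := by
    rw [← log_inv]
    exact log_le_log (inv_pos.2 (by linarith)) (inv_one_sub_exp_neg_le ht)
  have hsum := sum_neg_log_one_sub_exp_le _ hpos hm hexp ht
  have hbound : (ℓ : ℝ) * (π ^ 2 / (6 * m * t) - log (1 - exp (-t))) ≤
      ℓ * (π ^ 2 / (6 * m * t) + log (1 / t + 1)) := by
    gcongr
    linarith
  rcases Nat.eq_zero_or_pos (partCount A n) with h0 | h0
  · have : 0 ≤ log (1 / t + 1) := log_nonneg (by linarith [one_div_pos.2 ht])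
    rw [h0]
    simp only [Nat.cast_zero, log_zero]
    positivity
  · have hp : (0 : ℝ) < partCount A n := by exact_mod_cast h0
    have h := log_le_log (by positivity) (partCount_mul_pow_le_prod A n _ hmem hpos hx0.le hx1)
    rw [log_mul hp.ne' (by positivity), log_pow, log_exp,
      log_prod fun a ha => (inv_pos.2 (hfac a ha)).ne'] at h
    simp_rw [log_inv] at h
    linarith

lemma tendsto_log_one_add_mul_div_atTop {c : ℝ} (hc : 0 < c) :
    Tendsto (fun S : ℝ => log (c * S + 1) / S) atTop (nhds 0) := by
  have h1 : Tendsto (fun S : ℝ => c * S + 1) atTop atTop :=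
    tendsto_atTop_add_const_right _ _ (tendsto_id.const_mul_atTop hc)
  have h2 := (isLittleO_log_id_atTop.comp_tendsto h1)
  have h3 : (fun S : ℝ => c * S + 1) =O[atTop] (fun S : ℝ => S) :=
    ((Asymptotics.isBigO_refl _ _).const_mul_left c).add
      (Asymptotics.isLittleO_const_id_atTop (1 : ℝ)).isBigO
  exact (h2.trans_isBigO h3).tendsto_div_nhds_zero

theorem stmt_1 (m ℓ : ℕ) (hm : 0 < m) (hℓ : 0 < ℓ) (r : Fin ℓ → ℕ)
    (hmono : StrictMono r) (hr1 : ∀ i, 1 ≤ r i) (hrm : ∀ i, r i ≤ m)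
    (A : Set ℕ) (hA : A = {a : ℕ | 0 < a ∧ ∃ i, a ≡ r i [MOD m]}) :
    Filter.limsup
      (fun n : ℕ =>
        Real.log (partCount A n) / (π * Real.sqrt (2 * ℓ * n / (3 * m))))
      atTop ≤ 1 := by
  subst hA
  have hm' : (0 : ℝ) < m := by exact_mod_cast hm
  have hℓ' : (0 : ℝ) < ℓ := by exact_mod_cast hℓ
  set S : ℕ → ℝ := fun n => π * √(2 * ℓ * n / (3 * m)) with hS
  set K : ℝ := π ^ 2 * (2 * ℓ / (3 * m)) with hK
  have hKpos : 0 < K := by positivity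
  have hS2 : ∀ n, S n ^ 2 = K * n := fun n => by
    rw [hS, hK]
    simp only
    rw [mul_pow, sq_sqrt (by positivity)]
    ring
  have hStop : Tendsto S atTop atTop := by
    refine (tendsto_sqrt_atTop.comp ?_).const_mul_atTop pi_pos
    have h : (fun n : ℕ => (2 * ℓ * n / (3 * m) : ℝ)) = fun n : ℕ => (2 * ℓ / (3 * m) : ℝ) * n := by
      ext n
      ring
    rw [h]
    exact tendsto_natCast_atTop_atTop.const_mul_atTop (by positivity)
  have hlim : Tendsto (fun n => 1 + ℓ * (log (2 / K * S n + 1) / S n)) atTop (nhds 1) := by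
    simpa using (((tendsto_log_one_add_mul_div_atTop (c := 2 / K) (by positivity)).comp
      hStop).const_mul (ℓ : ℝ)).const_add 1
  rw [← hlim.limsup_eq]
  refine limsup_le_limsup ?_ ?_ hlim.isBoundedUnder_le
  · filter_upwards [eventually_gt_atTop 0] with n hn
    have hn' : (0 : ℝ) < n := by exact_mod_cast hn
    have hSpos : 0 < S n := by
      simp only [hS]
      positivity
    have h := log_partCount_le hm r hr1 hrm n (t := S n / (2 * n)) (by positivity)
    have e1 : S n / (2 * n) * n = S n / 2 := by field_simp
    have e2 : ℓ * (π ^ 2 / (6 * m * (S n / (2 * n)))) = S n / 2 := by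
      have := hS2 n
      rw [hK] at this
      field_simp at this ⊢
      linarith
    have e3 : 1 / (S n / (2 * n)) = 2 / K * S n := by
      have := hS2 n
      field_simp
      linarith
    rw [mul_add, e1, e2, e3] at h
    rw [div_le_iff₀ hSpos]
    calc _ ≤ _ := h
      _ = _ := by
        field_simp
        ring
  · refine isCoboundedUnder_le_of_le atTop (x := 0) fun n => ?_
    exact div_nonneg (log_natCast_nonneg _) (by positivity)
end

section
/- Let q(n) denote the number of partitions of n into distinct parts. Then log q(n) ∼ π√(n/3) as n → ∞, i.e., the ratio log q(n) / (π√(n/3)) tends to 1. -/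
open Filter Real

namespace Nat.Partition

/-- Adding a part `1` injects the partitions of `n` into odd parts into those of `n + 1`. -/
theorem card_odds_le_card_odds_succ (n : ℕ) : (odds n).card ≤ (odds (n + 1)).card := by
  let f (p : n.Partition) : (n + 1).Partition :=
    { parts := 1 ::ₘ p.parts
      parts_pos := by
        intro i hi
        rcases Multiset.mem_cons.1 hi with rfl | hi
        · exact Nat.one_pos
        · exact p.parts_pos hi
      parts_sum := by rw [Multiset.sum_cons, p.parts_sum, add_comm] }
  refine Finset.card_le_card_of_injOn f (fun p hp => ?_) (fun p _ q _ h => ?_)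
  · simp only [odds, restricted, Finset.coe_filter, Finset.mem_univ, true_and,
      Set.mem_ofPred_eq] at hp ⊢
    intro i hi
    rcases Multiset.mem_cons.1 hi with rfl | hi
    · decide
    · exact hp i hi
  · exact Nat.Partition.ext (Multiset.cons_inj_right 1 |>.1 (congrArg parts h))

theorem monotone_card_distincts : Monotone fun n : ℕ => (distincts n).card :=
  monotone_nat_of_le_succ fun n => by
    simpa only [card_odds_eq_card_distincts] using card_odds_le_card_odds_succ n

theorem one_le_card_distincts (n : ℕ) : 1 ≤ (distincts n).card := by
  refine le_trans ?_ (monotone_card_distincts (Nat.zero_le n))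
  decide

/-- Partitions of `n` into distinct parts correspond to finite sets `s` of natural numbers with
`∑ i ∈ s, (i + 1) = n`. -/
theorem natCard_finset_sum_succ_eq (n : ℕ) :
    Nat.card ((fun s : Finset ℕ => ∑ i ∈ s, (i + 1)) ⁻¹' {n}) = (distincts n).card := by
  let f (s : (fun s : Finset ℕ => ∑ i ∈ s, (i + 1)) ⁻¹' {n}) : distincts n :=
    ⟨{ parts := s.1.val.map (· + 1)
       parts_pos := by
         intro i hi
         obtain ⟨j, -, rfl⟩ := Multiset.mem_map.1 hi
         exact Nat.succ_pos j
       parts_sum := s.2 },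
      Finset.mem_filter.2 ⟨Finset.mem_univ _, s.1.nodup.map (add_left_injective 1)⟩⟩
  have hf : Function.Bijective f := by
    refine ⟨fun s s' h => ?_, fun p => ?_⟩
    · have h' : s.1.val.map (· + 1) = s'.1.val.map (· + 1) :=
        congrArg (fun p : distincts n => p.1.parts) h
      exact Subtype.ext (Finset.val_injective
        (Multiset.map_injective (add_left_injective 1) h'))
    · have hnodup : p.1.parts.Nodup := (Finset.mem_filter.1 p.2).2
      have hparts : (p.1.parts.map (· - 1)).map (· + 1) = p.1.parts := by
        rw [Multiset.map_map]
        conv_rhs => rw [← Multiset.map_id p.1.parts]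
        exact Multiset.map_congr rfl fun i hi => Nat.sub_add_cancel (p.1.parts_pos hi)
      refine ⟨⟨⟨p.1.parts.map (· - 1), ?_⟩, ?_⟩, Subtype.ext (Nat.Partition.ext hparts)⟩
      · exact Multiset.Nodup.of_map (· + 1) (hparts.symm ▸ hnodup)
      · change ((p.1.parts.map (· - 1)).map (· + 1)).sum = n
        rw [hparts, p.1.parts_sum]
  rw [Nat.card_congr (Equiv.ofBijective f hf), Nat.card_eq_fintype_card, Fintype.card_coe]

end Nat.Partition

theorem hasSum_log_one_add_pow {x : ℝ} (h0 : 0 < x) (h1 : x < 1) :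
    HasSum (fun k : ℕ => log (1 + x ^ (k + 1)))
      (∑' m : ℕ, x ^ (m + 1) / (1 - (x ^ (m + 1)) ^ 2) / (m + 1)) := by
  let f : ℕ × ℕ → ℝ := fun p =>
    ((x ^ (p.1 + 1)) ^ (p.2 + 1) - ((x ^ (p.1 + 1)) ^ (p.2 + 1)) ^ 2) / (p.2 + 1)
  have hpow (k : ℕ) : 0 < x ^ (k + 1) ∧ x ^ (k + 1) < 1 :=
    ⟨by positivity, pow_lt_one₀ h0.le h1 (by simp)⟩
  have hf : Summable f := by
    have hg := summable_geometric_of_lt_one h0.le h1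
    refine Summable.of_nonneg_of_le (fun p => ?_) (fun p => ?_)
      (hg.mul_of_nonneg hg (fun _ => by positivity) (fun _ => by positivity))
    · have h2 : (x ^ (p.1 + 1)) ^ (p.2 + 1) ≤ 1 := pow_le_one₀ (hpow _).1.le (hpow _).2.le
      have h3 : 0 < (x ^ (p.1 + 1)) ^ (p.2 + 1) := pow_pos (hpow _).1 _
      exact div_nonneg (by nlinarith) (by positivity)
    · calc f p ≤ (x ^ (p.1 + 1)) ^ (p.2 + 1) := by
            have hm : (0 : ℝ) ≤ p.2 := Nat.cast_nonneg _
            rw [div_le_iff₀ (by positivity)]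
            nlinarith [pow_pos (hpow p.1).1 (p.2 + 1),
              mul_nonneg (pow_pos (hpow p.1).1 (p.2 + 1)).le hm]
        _ ≤ x ^ p.1 * x ^ p.2 := by
            rw [← pow_mul, ← pow_add]
            exact pow_le_pow_of_le_one h0.le h1.le (by nlinarith)
  have hrow (k : ℕ) : HasSum (fun m => f (k, m)) (log (1 + x ^ (k + 1))) := by
    obtain ⟨hy0, hy1⟩ := hpow k
    have ha := hasSum_pow_div_log_of_abs_lt_one (x := x ^ (k + 1)) (by rwa [abs_of_pos hy0])
    have hb := hasSum_pow_div_log_of_abs_lt_one (x := (x ^ (k + 1)) ^ 2)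
      (by rw [abs_of_pos (by positivity)]; nlinarith)
    convert! ha.sub hb using 1
    · ext m
      simp only [f]
      ring
    · rw [show 1 - (x ^ (k + 1)) ^ 2 = (1 - x ^ (k + 1)) * (1 + x ^ (k + 1)) by ring,
        log_mul (by linarith) (by linarith)]
      ring
  have hcol (m : ℕ) : HasSum (fun k => f (k, m))
      (x ^ (m + 1) / (1 - (x ^ (m + 1)) ^ 2) / (m + 1)) := by
    obtain ⟨hy0, hy1⟩ := hpow m
    have hy2 : (x ^ (m + 1)) ^ 2 < 1 := by nlinarith
    have ha := (hasSum_geometric_of_lt_one hy0.le hy1).mul_left (x ^ (m + 1))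
    have hb := (hasSum_geometric_of_lt_one (by positivity) hy2).mul_left ((x ^ (m + 1)) ^ 2)
    convert! (ha.sub hb).div_const ((m : ℝ) + 1) using 1
    · ext k
      simp only [f]
      ring
    · congr 1
      have : 1 - x ^ (m + 1) ≠ 0 := by linarith
      have : 1 + x ^ (m + 1) ≠ 0 := by linarith
      rw [show 1 - (x ^ (m + 1)) ^ 2 = (1 - x ^ (m + 1)) * (1 + x ^ (m + 1)) by ring]
      field_simp
      ring
  have h := hf.hasSum.prod_fiberwise hrow
  have h' := ((Equiv.prodComm ℕ ℕ).hasSum_iff.2 hf.hasSum).prod_fiberwise hcol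
  rwa [h'.tsum_eq]

/-- The logarithm of the generating function of partitions into distinct parts at `exp (-t)`. -/
noncomputable def logDistinctsGenFun (t : ℝ) : ℝ :=
  ∑' m : ℕ, 1 / (2 * ((m : ℝ) + 1) * sinh ((m + 1) * t))

theorem hasSum_card_distincts_mul_exp {t : ℝ} (ht : 0 < t) :
    HasSum (fun n : ℕ => ((Nat.Partition.distincts n).card : ℝ) * exp (-(t * n)))
      (exp (logDistinctsGenFun t)) := by
  set x := exp (-t) with hx
  have h0 : 0 < x := exp_pos _
  have h1 : x < 1 := Real.exp_lt_one_iff.2 (by linarith)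
  have hlog := hasSum_log_one_add_pow h0 h1
  have hval : ∑' m : ℕ, x ^ (m + 1) / (1 - (x ^ (m + 1)) ^ 2) / (m + 1)
      = logDistinctsGenFun t := by
    refine tsum_congr fun m => ?_
    have hxm : x ^ (m + 1) = exp (-((m + 1) * t)) := by
      rw [hx, ← exp_nat_mul]; push_cast; ring_nf
    have hlt : x ^ (m + 1) < 1 := pow_lt_one₀ h0.le h1 (by simp)
    have hpos : 0 < x ^ (m + 1) := by positivity
    have hinv : exp ((m + 1) * t) = (x ^ (m + 1))⁻¹ := by rw [hxm, exp_neg, inv_inv]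
    rw [sinh_eq, hinv, ← hxm]
    generalize x ^ (m + 1) = y at hlt hpos
    have : 1 - y ^ 2 ≠ 0 := by nlinarith
    field_simp
  rw [hval] at hlog
  have hprod := hasProd_of_hasSum_log (fun k => by positivity) hlog
  have hsum : Summable fun k : ℕ => x ^ (k + 1) :=
    (summable_nat_add_iff 1).2 (summable_geometric_of_lt_one h0.le h1)
  have hfin := hprod.tprod_eq ▸ tprod_one_add (summable_finsetProd_of_summable_nonneg
    (fun k => by positivity) hsum) ▸ (summable_finsetProd_of_summable_nonneg
    (fun k => by positivity) hsum).hasSum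
  convert! hfin.tsum_fiberwise (fun s : Finset ℕ => ∑ i ∈ s, (i + 1)) using 1
  ext n
  rw [← Nat.Partition.natCard_finset_sum_succ_eq, ← nsmul_eq_mul, ← tsum_const]
  refine tsum_congr fun s => ?_
  rw [Finset.prod_pow_eq_pow_sum, show ∑ i ∈ s.1, (i + 1) = n from s.2, hx, ← exp_nat_mul]
  ring_nf

theorem hasSum_one_div_two_mul_succ_sq :
    HasSum (fun m : ℕ => 1 / (2 * ((m : ℝ) + 1) ^ 2)) (π ^ 2 / 12) := by
  have h := (hasSum_nat_add_iff' 1).2 hasSum_zeta_two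
  convert! h.div_const 2 using 1
  · ext m
    push_cast
    field_simp
  · simp
    ring

theorem mul_one_div_sinh_le {t : ℝ} (ht : 0 < t) (m : ℕ) :
    t * (1 / (2 * ((m : ℝ) + 1) * sinh ((m + 1) * t))) ≤ 1 / (2 * ((m : ℝ) + 1) ^ 2) := by
  have h : ((m : ℝ) + 1) * t ≤ sinh ((m + 1) * t) := self_le_sinh_iff.2 (by positivity)
  have h' : 0 < sinh (((m : ℝ) + 1) * t) := lt_of_lt_of_le (by positivity) h
  rw [mul_one_div, div_le_div_iff₀ (by positivity) (by positivity)]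
  nlinarith [mul_le_mul_of_nonneg_left h (show (0 : ℝ) ≤ 2 * (m + 1) by positivity)]

theorem logDistinctsGenFun_le {t : ℝ} (ht : 0 < t) :
    logDistinctsGenFun t ≤ π ^ 2 / 12 / t := by
  rw [le_div_iff₀ ht, mul_comm, logDistinctsGenFun, ← tsum_mul_left,
    ← hasSum_one_div_two_mul_succ_sq.tsum_eq]
  have hn (m : ℕ) : 0 ≤ t * (1 / (2 * ((m : ℝ) + 1) * sinh ((m + 1) * t))) := by
    have : 0 < sinh (((m : ℝ) + 1) * t) := sinh_pos_iff.2 (by positivity)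
    positivity
  exact (Summable.of_nonneg_of_le hn (mul_one_div_sinh_le ht)
    hasSum_one_div_two_mul_succ_sq.summable).tsum_le_tsum (mul_one_div_sinh_le ht)
    hasSum_one_div_two_mul_succ_sq.summable

theorem tendsto_mul_logDistinctsGenFun :
    Tendsto (fun t => t * logDistinctsGenFun t) (nhdsWithin 0 (Set.Ioi 0)) (nhds (π ^ 2 / 12)) := by
  simp_rw [logDistinctsGenFun, ← tsum_mul_left, ← hasSum_one_div_two_mul_succ_sq.tsum_eq]
  refine tendsto_tsum_of_dominated_convergence hasSum_one_div_two_mul_succ_sq.summable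
    (fun m => ?_) ?_
  · have hd : HasDerivAt (fun t : ℝ => sinh (((m : ℝ) + 1) * t)) ((m : ℝ) + 1) 0 := by
      simpa using ((hasDerivAt_id (0 : ℝ)).const_mul ((m : ℝ) + 1)).sinh
    have h1 := (hd.tendsto_slope_zero_right.inv₀ (by positivity)).div_const (2 * ((m : ℝ) + 1))
    refine (h1.congr fun t => ?_).trans_eq ?_
    · simp
      field_simp
    · congr 1
      field_simp
  · filter_upwards [self_mem_nhdsWithin] with t ht m
    have ht : 0 < t := ht
    have : 0 < sinh (((m : ℝ) + 1) * t) := sinh_pos_iff.2 (by positivity)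
    rw [norm_of_nonneg (by positivity)]
    exact mul_one_div_sinh_le ht m

theorem log_card_distincts_le {n : ℕ} (hn : 0 < n) :
    log (Nat.Partition.distincts n).card ≤ π * sqrt (n / 3) := by
  set s := sqrt ((n : ℝ) / 3)
  have hs0 : 0 < s := sqrt_pos.2 (by positivity)
  have hns : (n : ℝ) = 3 * s ^ 2 := by rw [sq_sqrt (by positivity)]; ring
  clear_value s
  have hq : (0 : ℝ) < (Nat.Partition.distincts n).card :=
    Nat.cast_pos.2 (Nat.Partition.one_le_card_distincts n)
  have ht : 0 < π / (6 * s) := by positivity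
  have h := (le_hasSum (hasSum_card_distincts_mul_exp ht) n fun m _ => by positivity).trans
    (exp_le_exp.2 (logDistinctsGenFun_le ht))
  have h' := log_le_log (by positivity) h
  rw [log_exp, log_mul hq.ne' (exp_pos _).ne', log_exp] at h'
  have h1 : π / (6 * s) * n = π * s / 2 := by rw [hns]; field_simp; norm_num
  have h2 : π ^ 2 / 12 / (π / (6 * s)) = π * s / 2 := by field_simp; norm_num
  linarith

/-- The generating function at `exp (-t)` is bounded by a central part `L < t * m`, `m < n`,
estimated by monotonicity, and two tails, estimated by the generating function at nearby points. -/
theorem exp_logDistinctsGenFun_le {t δ : ℝ} (ht : 0 < t) (hδ0 : 0 < δ) (hδ1 : δ < 1) (L : ℝ)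
    (n : ℕ) :
    exp (logDistinctsGenFun t) ≤ n * ((Nat.Partition.distincts n).card * exp (-L)) +
      exp (-(δ * (t * n))) * exp (logDistinctsGenFun ((1 - δ) * t)) +
      exp (δ * L) * exp (logDistinctsGenFun ((1 + δ) * t)) := by
  set c : ℝ := (Nat.Partition.distincts n).card * exp (-L) with hc
  have hmid : HasSum (fun m : ℕ => if m ∈ Finset.range n then c else 0) (n * c) := by
    have h := hasSum_sum_of_ne_finset_zero (s := Finset.range n)
      (f := fun m : ℕ => if m ∈ Finset.range n then c else 0) (L := .unconditional ℕ)
      (fun m hm => if_neg hm)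
    rwa [Finset.sum_congr rfl fun m hm => if_pos hm, Finset.sum_const, Finset.card_range,
      nsmul_eq_mul] at h
  have hup := (hasSum_card_distincts_mul_exp (t := (1 - δ) * t)
    (mul_pos (by linarith) ht)).mul_left (exp (-(δ * (t * n))))
  have hlo := (hasSum_card_distincts_mul_exp (t := (1 + δ) * t)
    (mul_pos (by linarith) ht)).mul_left (exp (δ * L))
  refine hasSum_le (fun m => ?_) (hasSum_card_distincts_mul_exp ht) ((hmid.add hup).add hlo)
  set q := ((Nat.Partition.distincts m).card : ℝ)
  have hq : 0 ≤ q := Nat.cast_nonneg _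
  have hmid0 : 0 ≤ if m ∈ Finset.range n then c else 0 := by split_ifs <;> positivity
  have hup0 : 0 ≤ exp (-(δ * (t * n))) * (q * exp (-((1 - δ) * t * m))) := by positivity
  have hlo0 : 0 ≤ exp (δ * L) * (q * exp (-((1 + δ) * t * m))) := by positivity
  rcases le_or_gt n m with hnm | hnm
  · have hnm' : t * (n : ℝ) ≤ t * m := by gcongr
    have : q * exp (-(t * m)) ≤ exp (-(δ * (t * n))) * (q * exp (-((1 - δ) * t * m))) := by
      rw [mul_left_comm, ← exp_add]
      gcongr
      nlinarith
    linarith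
  rcases le_or_gt (t * m) L with hL | hL
  · have : q * exp (-(t * m)) ≤ exp (δ * L) * (q * exp (-((1 + δ) * t * m))) := by
      rw [mul_left_comm, ← exp_add]
      gcongr
      nlinarith
    linarith
  · have : q * exp (-(t * m)) ≤ c := by
      rw [hc]
      gcongr
      exact Nat.cast_le.2 (Nat.Partition.monotone_card_distincts hnm.le)
    rw [if_pos (Finset.mem_range.2 hnm)]
    linarith

theorem tendsto_sqrt_div_three : Tendsto (fun n : ℕ => sqrt ((n : ℝ) / 3)) atTop atTop :=
  tendsto_sqrt_atTop.comp (tendsto_natCast_atTop_atTop.atTop_div_const (by norm_num))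

theorem eventually_le_log_card_distincts {δ : ℝ} (hδ0 : 0 < δ) (hδ1 : δ ≤ 1 / 8) :
    ∀ᶠ n : ℕ in atTop, (1 - 4 * δ) * (π * sqrt (n / 3)) - log (2 * n) ≤
      log (Nat.Partition.distincts n).card := by
  have hT : Tendsto (fun n : ℕ => π * (1 + 2 * δ) / 6 / sqrt ((n : ℝ) / 3)) atTop
      (nhdsWithin 0 (Set.Ioi 0)) := by
    refine tendsto_nhdsWithin_iff.2 ⟨tendsto_sqrt_div_three.const_div_atTop _, ?_⟩
    filter_upwards [eventually_gt_atTop 0] with n hn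
    exact div_pos (by positivity) (sqrt_pos.2 (by positivity))
  have hB : Tendsto (fun n : ℕ => π / (2 * (1 + 2 * δ)) * δ ^ 2 * sqrt ((n : ℝ) / 3))
      atTop atTop := tendsto_sqrt_div_three.const_mul_atTop (by positivity)
  have hW := (hT.eventually (tendsto_mul_logDistinctsGenFun.eventually
    (lt_mem_nhds (show π ^ 2 / 12 * (1 - δ ^ 2) < π ^ 2 / 12 by
      have := sq_pos_of_pos pi_pos
      nlinarith [mul_pos this (pow_pos hδ0 2)]))))
  filter_upwards [hW, hB.eventually_ge_atTop (log 4), eventually_gt_atTop 0] with n hWn hBn hn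
  set s := sqrt ((n : ℝ) / 3)
  have hs0 : 0 < s := sqrt_pos.2 (by positivity)
  have hns : (n : ℝ) = 3 * s ^ 2 := by rw [sq_sqrt (by positivity)]; ring
  clear_value s
  set t := π * (1 + 2 * δ) / 6 / s with ht
  set B := π / (2 * (1 + 2 * δ)) * s with hBdef
  have ht0 : 0 < t := by positivity
  have hB0 : 0 < B := by positivity
  have hBt : π ^ 2 / 12 / t = B := by rw [ht, hBdef]; field_simp; norm_num
  have htn : t * n = B * (1 + 2 * δ) ^ 2 := by rw [ht, hBdef, hns]; field_simp; norm_num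
  have hlow : B * (1 - δ ^ 2) ≤ logDistinctsGenFun t := by
    rw [← hBt, div_mul_eq_mul_div, div_le_iff₀ ht0]
    linarith
  have hup : logDistinctsGenFun ((1 - δ) * t) ≤ B * (1 + δ + 2 * δ ^ 2) := by
    refine (logDistinctsGenFun_le (mul_pos (by linarith) ht0)).trans ?_
    rw [mul_comm, ← div_div, hBt, div_le_iff₀ (by linarith), mul_assoc]
    refine le_mul_of_one_le_right hB0.le ?_
    nlinarith [mul_nonneg (sq_nonneg δ) (show 0 ≤ 1 - 2 * δ by linarith)]
  have hdown : logDistinctsGenFun ((1 + δ) * t) ≤ B * (1 - δ + δ ^ 2) := by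
    refine (logDistinctsGenFun_le (mul_pos (by linarith) ht0)).trans ?_
    rw [mul_comm, ← div_div, hBt, div_le_iff₀ (by linarith), mul_assoc]
    refine le_mul_of_one_le_right hB0.le ?_
    nlinarith [pow_pos hδ0 3]
  have hmain := exp_logDistinctsGenFun_le ht0 hδ0 (by linarith) (B * (1 - 3 * δ)) n
  set q := ((Nat.Partition.distincts n).card : ℝ)
  have hq : 0 < q := Nat.cast_pos.2 (Nat.Partition.one_le_card_distincts n)
  have hn' : (0 : ℝ) < n := Nat.cast_pos.2 hn
  have htail {u v : ℝ} (h : u + v ≤ B * (1 - 2 * δ ^ 2)) :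
      exp u * exp v ≤ exp (B * (1 - δ ^ 2)) / 4 := by
    rw [← exp_add, ← exp_log (show (0 : ℝ) < 4 by norm_num), ← exp_sub]
    exact exp_le_exp.2 (by nlinarith)
  have h1 := htail (u := -(δ * (t * n))) (v := logDistinctsGenFun ((1 - δ) * t)) (by
    rw [htn]
    nlinarith [mul_pos hB0 (pow_pos hδ0 3), mul_pos hB0 (pow_pos hδ0 2)])
  have h2 := htail (u := δ * (B * (1 - 3 * δ))) (v := logDistinctsGenFun ((1 + δ) * t)) (by
    nlinarith)
  have h3 : exp (B * (1 - δ ^ 2)) ≤ 2 * n * q * exp (-(B * (1 - 3 * δ))) := by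
    linarith [exp_le_exp.2 hlow]
  have h4 := log_le_log (exp_pos _) h3
  rw [log_exp, log_mul (by positivity) (exp_pos _).ne', log_exp,
    log_mul (by positivity) hq.ne'] at h4
  have hpis : π * s = 2 * (1 + 2 * δ) * B := by rw [hBdef]; field_simp
  rw [hpis]
  nlinarith [mul_pos hB0 hδ0, mul_pos hB0 (pow_pos hδ0 2)]

theorem tendsto_log_two_mul_div_sqrt :
    Tendsto (fun n : ℕ => log (2 * n) / (π * sqrt ((n : ℝ) / 3))) atTop (nhds 0) := by
  have h := (isLittleO_log_rpow_atTop (show (0 : ℝ) < 1 / 2 by norm_num)).tendsto_div_nhds_zero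
  have h' := (h.comp (tendsto_natCast_atTop_atTop.const_mul_atTop
    (show (0 : ℝ) < 2 by norm_num))).mul_const (sqrt 6 / π)
  rw [zero_mul] at h'
  refine h'.congr fun n => ?_
  have h6 : sqrt (2 * (n : ℝ)) = sqrt 6 * sqrt (n / 3) := by
    rw [← sqrt_mul (by norm_num)]; ring_nf
  simp only [Function.comp_apply, ← sqrt_eq_rpow, h6]
  field_simp

theorem stmt_3 :
    Tendsto
      (fun n : ℕ =>
        Real.log ((Nat.Partition.distincts n).card) / (π * Real.sqrt (n / 3)))
      atTop (nhds 1) := by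
  refine tendsto_order.2 ⟨fun a ha => ?_, fun a ha => ?_⟩
  · set δ := min (1 / 8) ((1 - a) / 5)
    have hδ0 : 0 < δ := lt_min (by norm_num) (by linarith)
    have hδa : δ ≤ (1 - a) / 5 := min_le_right _ _
    filter_upwards [eventually_le_log_card_distincts hδ0 (min_le_left _ _),
      tendsto_log_two_mul_div_sqrt.eventually (gt_mem_nhds hδ0), eventually_gt_atTop 0]
      with n h1 h2 hn
    have hpos : 0 < π * sqrt ((n : ℝ) / 3) := mul_pos pi_pos (sqrt_pos.2 (by positivity))
    rw [div_lt_iff₀ hpos] at h2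
    rw [lt_div_iff₀ hpos]
    nlinarith
  · filter_upwards [eventually_gt_atTop 0] with n hn
    have hpos : 0 < π * sqrt ((n : ℝ) / 3) := mul_pos pi_pos (sqrt_pos.2 (by positivity))
    exact ((div_le_one hpos).2 (log_card_distincts_le hn)).trans_lt ha
end

section
/- Let m, ℓ, r_1, …, r_ℓ be positive integers with 1 ≤ r_1 < r_2 < ⋯ < r_ℓ ≤ m, and let A be the set of all positive integers a such that a ≡ r_i (mod m) for some i ∈ {1, …, ℓ}. Let ϑ > −1 be a real number, c_0 = π√(2ℓ/(3m)), and c_1 = √(1+ϑ)·c_0. Then for every ε > 0, Σ_{k=1}^{∞} Σ_{a∈A} a·e^{−c_1 k a/(2√n)} = n/(1+ϑ) + O(n^{1/2+ε}) as the positive integer n → ∞. -/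
open Real

/-- The closed form of `∑ a e^{-xa}` over the progression `r, r + m, r + 2m, …`. -/
lemma hasSum_progression_mul_exp_neg (m r : ℕ) (hm : 0 < m) {x : ℝ} (hx : 0 < x) :
    HasSum (fun q : ℕ => ((r + q * m : ℕ) : ℝ) * exp (-(x * (r + q * m : ℕ))))
      (r * exp (-(r * x)) / (1 - exp (-(m * x))) +
        m * exp (-(r * x)) * (exp (-(m * x)) / (1 - exp (-(m * x))) ^ 2)) := by
  have hmx : 0 < (m : ℝ) * x := by positivity
  have hlt : exp (-(m * x)) < 1 := exp_lt_one_iff.2 (by linarith)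
  have hgeom := (hasSum_geometric_of_lt_one (exp_pos (-(m * x))).le hlt).mul_left
    (r * exp (-(r * x)))
  have hcoe := (hasSum_coe_mul_geometric_of_norm_lt_one (r := exp (-(m * x)))
    (by rwa [norm_of_nonneg (exp_pos _).le])).mul_left (m * exp (-(r * x)))
  rw [← div_eq_mul_inv] at hgeom
  refine (hgeom.add hcoe).congr_fun fun q => ?_
  have hexp : exp (-(x * (r + q * m : ℕ))) = exp (-(r * x)) * exp (-(m * x)) ^ q := by
    rw [← exp_nat_mul, ← exp_add]
    push_cast
    ring_nf
  rw [hexp]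
  push_cast
  ring

lemma exp_neg_div_one_sub_sq_le {u : ℝ} (hu : 0 < u) :
    exp (-u) / (1 - exp (-u)) ^ 2 ≤ 1 / u ^ 2 := by
  have hlt : exp (-u) < 1 := exp_lt_one_iff.2 (by linarith)
  have hsinh : u / 2 ≤ sinh (u / 2) := self_le_sinh_iff.2 (by linarith)
  have hhalf : exp (-u) = exp (-(u / 2)) ^ 2 := by
    rw [← exp_nat_mul]
    push_cast
    ring_nf
  have hinv : exp (u / 2) * exp (-(u / 2)) = 1 := by
    rw [← exp_add]
    simp
  have hle : u * exp (-(u / 2)) ≤ 1 - exp (-u) := by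
    rw [sinh_eq] at hsinh
    have := mul_le_mul_of_nonneg_right hsinh (exp_pos (-(u / 2))).le
    rw [hhalf]
    nlinarith
  have hden : 0 < 1 - exp (-u) := by linarith
  rw [div_le_div_iff₀ (by positivity) (by positivity)]
  have := pow_le_pow_left₀ (by positivity) hle 2
  rw [mul_pow, ← hhalf] at this
  linarith

lemma exp_neg_div_sq_le {u : ℝ} (hu : 0 < u) :
    exp (-u) / u ^ 2 ≤ exp (-u) / (1 - exp (-u)) ^ 2 := by
  have hlt : 0 < 1 - exp (-u) := by
    have := exp_lt_one_iff (x := -u) |>.2 (by linarith)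
    linarith
  have hle : 1 - exp (-u) ≤ u := by linarith [add_one_le_exp (-u)]
  gcongr

lemma exp_neg_div_one_sub_exp_neg_le (m r : ℕ) (hm : 0 < m) (hr : 1 ≤ r) {x : ℝ} (hx : 0 < x) :
    exp (-(r * x)) / (1 - exp (-(m * x))) ≤ 1 / x ∧
      exp (-(r * x)) / (1 - exp (-(m * x))) ≤ 2 / x ^ 2 := by
  have hm1 : (1 : ℝ) ≤ m := by exact_mod_cast hm
  have hr1 : (1 : ℝ) ≤ r := by exact_mod_cast hr
  have hden : 0 < 1 - exp (-x) := by
    have := exp_lt_one_iff (x := -x) |>.2 (by linarith)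
    linarith
  have hmain : exp (-(r * x)) / (1 - exp (-(m * x))) ≤ exp (-x) / (1 - exp (-x)) := by
    gcongr
    · nlinarith
    · nlinarith
  have hrw : exp (-x) / (1 - exp (-x)) = 1 / (exp x - 1) := by
    have h1 : exp x - 1 ≠ 0 := by
      have := add_one_lt_exp hx.ne'
      linarith
    rw [div_eq_div_iff hden.ne' h1, mul_sub, ← exp_add]
    simp
  have hquad := quadratic_le_exp_of_nonneg hx.le
  rw [hrw] at hmain
  refine ⟨hmain.trans ?_, hmain.trans ?_⟩
  · gcongr
    nlinarith [sq_nonneg x]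
  · rw [div_le_div_iff₀ (by nlinarith [sq_nonneg x]) (by positivity)]
    nlinarith

lemma abs_progression_closedForm_sub_le (m r : ℕ) (hm : 0 < m) (hr : 1 ≤ r) (hrm : r ≤ m)
    {x : ℝ} (hx : 0 < x) :
    |r * exp (-(r * x)) / (1 - exp (-(m * x))) +
        m * exp (-(r * x)) * (exp (-(m * x)) / (1 - exp (-(m * x))) ^ 2) - 1 / (m * x ^ 2)| ≤
      min (3 * m / x) (3 * m / x ^ 2) := by
  have hm1 : (1 : ℝ) ≤ m := by exact_mod_cast hm
  have hr1 : (1 : ℝ) ≤ r := by exact_mod_cast hr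
  have hrm' : (r : ℝ) ≤ m := by exact_mod_cast hrm
  have hm0 : (0 : ℝ) < m := by linarith
  have hu : 0 < (m : ℝ) * x := by positivity
  have hden : 0 < 1 - exp (-(m * x)) := by
    have := exp_lt_one_iff (x := -(m * x)) |>.2 (by linarith)
    linarith
  obtain ⟨hone, htwo⟩ := exp_neg_div_one_sub_exp_neg_le m r hm hr hx
  set E := exp (-(r * x)) / (1 - exp (-(m * x))) with hE
  have hE0 : 0 ≤ E := by positivity
  have hfirst : r * exp (-(r * x)) / (1 - exp (-(m * x))) = r * E := by rw [hE, mul_div_assoc]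
  have hfirst_le : r * E ≤ m * E := by gcongr
  set S := m * exp (-(r * x)) * (exp (-(m * x)) / (1 - exp (-(m * x))) ^ 2) with hS
  have hS0 : 0 ≤ S := by positivity
  have hSle : S ≤ 1 / (m * x ^ 2) := by
    calc S ≤ m * 1 * (1 / (m * x) ^ 2) := by
          rw [hS]
          refine mul_le_mul (mul_le_mul_of_nonneg_left ?_ hm0.le) (exp_neg_div_one_sub_sq_le hu)
            (by positivity) (by positivity)
          exact exp_le_one_iff.2 (by nlinarith)
      _ = 1 / (m * x ^ 2) := by field_simp
  have hSge : 1 / (m * x ^ 2) - 2 / x ≤ S := by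
    have hlin : 1 - (r + m) * x ≤ exp (-(r * x)) * exp (-(m * x)) := by
      rw [← exp_add]
      linarith [add_one_le_exp (-(r * x) + -(m * x))]
    calc 1 / (m * x ^ 2) - 2 / x = (1 - (m + m) * x) / (m * x ^ 2) := by
          field_simp
          ring
      _ ≤ (exp (-(r * x)) * exp (-(m * x))) / (m * x ^ 2) := by
          gcongr
          nlinarith
      _ = m * exp (-(r * x)) * (exp (-(m * x)) / (m * x) ^ 2) := by field_simp
      _ ≤ S := by
          rw [hS]
          exact mul_le_mul_of_nonneg_left (exp_neg_div_sq_le hu) (by positivity)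
  have hrE : 0 ≤ r * E := by positivity
  have hsq : 1 / (m * x ^ 2) ≤ 1 / x ^ 2 := by
    gcongr
    nlinarith [sq_pos_of_pos hx]
  have hx1 : 0 < 1 / x := by positivity
  have hx2 : 0 < 1 / x ^ 2 := by positivity
  rw [show 2 / x = 2 * (1 / x) by ring] at hSge
  rw [show 2 / x ^ 2 = 2 * (1 / x ^ 2) by ring] at htwo
  have hmE1 : m * E ≤ m * (1 / x) := by gcongr
  have hmE2 : m * E ≤ m * (2 * (1 / x ^ 2)) := by gcongr
  have hmx1 : 1 / x ≤ m * (1 / x) := le_mul_of_one_le_left hx1.le hm1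
  have hmx2 : 1 / x ^ 2 ≤ m * (1 / x ^ 2) := le_mul_of_one_le_left hx2.le hm1
  rw [hfirst, show 3 * m / x = 3 * (m * (1 / x)) by ring,
    show 3 * m / x ^ 2 = 3 * (m * (1 / x ^ 2)) by ring, le_min_iff, abs_le, abs_le]
  refine ⟨⟨?_, ?_⟩, ?_, ?_⟩ <;> linarith

lemma min_div_le_mul_rpow_neg {c x s : ℝ} (hc : 0 ≤ c) (hx : 0 < x) (hs1 : 1 ≤ s) (hs2 : s ≤ 2) :
    min (c / x) (c / x ^ 2) ≤ c * x ^ (-s) := by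
  rcases le_total x 1 with h | h
  · refine (min_le_left _ _).trans ?_
    rw [div_eq_mul_inv, ← rpow_neg_one]
    gcongr 1
    exact rpow_le_rpow_of_exponent_ge hx h (by linarith)
  · refine (min_le_right _ _).trans ?_
    rw [div_eq_mul_inv, ← rpow_two, ← rpow_neg hx.le]
    gcongr 1
    exact rpow_le_rpow_of_exponent_le h (by linarith)

/-- The sum of `a e^{-xa}` over a union of `ℓ` residue classes is `ℓ / (m x²)` up to `O(x^{-s})`,
uniformly in `x > 0`, for each `s ∈ [1, 2]`. -/
lemma abs_tsum_residueClasses_mul_exp_neg_sub_le (m ℓ : ℕ) (hm : 0 < m) (r : Fin ℓ → ℕ)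
    (hr : Function.Injective r) (hr1 : ∀ i, 1 ≤ r i) (hrm : ∀ i, r i ≤ m) {x s : ℝ} (hx : 0 < x)
    (hs1 : 1 ≤ s) (hs2 : s ≤ 2) :
    |(∑' a : {a : ℕ | 0 < a ∧ ∃ i, a ≡ r i [MOD m]}, ((a : ℕ) : ℝ) * exp (-(x * (a : ℕ)))) -
        ℓ / (m * x ^ 2)| ≤ ℓ * (3 * m) * x ^ (-s) := by
  have hunion : {a : ℕ | 0 < a ∧ ∃ i, a ≡ r i [MOD m]} =
      ⋃ i ∈ (Finset.univ : Finset (Fin ℓ)), Set.range fun q : ℕ => r i + q * m := by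
    ext a
    simp only [Set.mem_ofPred_eq, Finset.mem_univ, Set.iUnion_true, Set.mem_iUnion, Set.mem_range]
    constructor
    · rintro ⟨ha, i, hi⟩
      have hle : r i ≤ a := by
        by_contra! hlt
        have hdvd := (Nat.modEq_iff_dvd' hlt.le).1 hi
        have := Nat.le_of_dvd (by omega) hdvd
        have := hrm i
        omega
      obtain ⟨q, hq⟩ := (Nat.modEq_iff_dvd' hle).1 hi.symm
      exact ⟨i, q, by rw [mul_comm q m]; omega⟩
    · rintro ⟨i, q, rfl⟩
      refine ⟨by have := hr1 i; omega, i, ?_⟩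
      simp [Nat.ModEq]
  have hdisj : ((Finset.univ : Finset (Fin ℓ)) : Set (Fin ℓ)).Pairwise
      (Function.onFun Disjoint fun i => Set.range fun q : ℕ => r i + q * m) := by
    intro i _ j _ hij
    refine Set.disjoint_left.2 ?_
    rintro _ ⟨p, rfl⟩ ⟨q, hq⟩
    refine hij (hr ?_)
    have hmod : r i - 1 ≡ r j - 1 [MOD m] := by
      refine Nat.ModEq.add_right_cancel' 1 ?_
      rw [Nat.sub_add_cancel (hr1 i), Nat.sub_add_cancel (hr1 j)]
      have : (r j + q * m) % m = (r i + p * m) % m := congrArg (· % m) hq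
      simpa [Nat.ModEq] using this.symm
    have hi := hr1 i
    have hj := hr1 j
    have := hmod.eq_of_lt_of_lt (by have := hrm i; omega) (by have := hrm j; omega)
    omega
  have hinj (i : Fin ℓ) : Function.Injective fun q : ℕ => r i + q * m := fun p q h => by
    simpa [hm.ne'] using h
  have hsum := hasSum_sum_disjoint (f := fun a : ℕ => (a : ℝ) * exp (-(x * a))) Finset.univ hdisj
    (fun i _ => ((hinj i).hasSum_range_iff (f := fun a : ℕ => (a : ℝ) * exp (-(x * a)))).2
      (hasSum_progression_mul_exp_neg m (r i) hm hx))
  rw [← hunion] at hsum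
  have heq := hsum.tsum_eq
  simp only [Function.comp_apply] at heq
  rw [heq]
  have hmain : (ℓ : ℝ) / (m * x ^ 2) = ∑ _i : Fin ℓ, 1 / (m * x ^ 2) := by
    simp [div_eq_mul_inv]
  have herr : (ℓ : ℝ) * (3 * m) * x ^ (-s) = ∑ _i : Fin ℓ, 3 * m * x ^ (-s) := by
    simp [mul_assoc]
  rw [hmain, herr, ← Finset.sum_sub_distrib]
  refine (Finset.abs_sum_le_sum_abs _ _).trans (Finset.sum_le_sum fun i _ => ?_)
  exact (abs_progression_closedForm_sub_le m (r i) hm (hr1 i) (hrm i) hx).trans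
    (min_div_le_mul_rpow_neg (by positivity) hx hs1 hs2)

lemma hasSum_one_div_succ_sq : HasSum (fun k : ℕ => 1 / ((k : ℝ) + 1) ^ 2) (π ^ 2 / 6) := by
  have h := (hasSum_nat_add_iff' 1).2 hasSum_zeta_two
  simpa using h

theorem stmt_11 (m ℓ : ℕ) (hm : 0 < m) (hℓ : 0 < ℓ) (r : Fin ℓ → ℕ)
    (hmono : StrictMono r) (hr1 : ∀ i, 1 ≤ r i) (hrm : ∀ i, r i ≤ m)
    (A : Set ℕ) (hA : A = {a : ℕ | 0 < a ∧ ∃ i, a ≡ r i [MOD m]})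
    (ϑ : ℝ) (hϑ : -1 < ϑ) (c₀ c₁ : ℝ)
    (hc₀ : c₀ = π * Real.sqrt (2 * ℓ / (3 * m)))
    (hc₁ : c₁ = Real.sqrt (1 + ϑ) * c₀)
    (ε : ℝ) (hε : 0 < ε) :
    ∃ C : ℝ, ∀ n : ℕ, 0 < n →
      |(∑' (k : ℕ) (a : A),
            ((a : ℕ) : ℝ) *
              Real.exp (-(c₁ * (k + 1) * (a : ℕ)) / (2 * Real.sqrt n))) -
          (n : ℝ) / (1 + ϑ)| ≤
        C * (n : ℝ) ^ ((1 : ℝ) / 2 + ε) := by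
  subst hA
  have hϑ' : 0 < 1 + ϑ := by linarith
  have hm' : (0 : ℝ) < m := by exact_mod_cast hm
  have hℓ' : (0 : ℝ) < ℓ := by exact_mod_cast hℓ
  have hc₁pos : 0 < c₁ := by
    rw [hc₁, hc₀]
    positivity
  have hc₁sq : c₁ ^ 2 = (1 + ϑ) * (π ^ 2 * (2 * ℓ / (3 * m))) := by
    rw [hc₁, hc₀, mul_pow, mul_pow, sq_sqrt hϑ'.le, sq_sqrt (by positivity)]
  set s : ℝ := min (1 + 2 * ε) 2
  have hs1 : 1 < s := lt_min (by linarith) (by norm_num)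
  have hs2 : s ≤ 2 := min_le_right _ _
  have hsε : s / 2 ≤ 1 / 2 + ε := by linarith [min_le_left (1 + 2 * ε) 2]
  have hZ : Summable fun k : ℕ => ((k : ℝ) + 1) ^ (-s) := by
    have := (summable_nat_add_iff 1).2 (summable_nat_rpow.2 (by linarith : -s < -1))
    simpa using this
  refine ⟨ℓ * (3 * m) * (c₁ / 2) ^ (-s) * ∑' k : ℕ, ((k : ℝ) + 1) ^ (-s), fun n hn => ?_⟩
  have hn1 : (1 : ℝ) ≤ n := by exact_mod_cast hn
  have hn0 : (0 : ℝ) < n := by linarith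
  set t : ℝ := c₁ / 2 / sqrt n with ht
  have htpos : 0 < t := by positivity
  have htpow : t ^ (-s) = (c₁ / 2) ^ (-s) * (n : ℝ) ^ (s / 2) := by
    rw [ht, div_rpow (by positivity) (by positivity), sqrt_eq_rpow, ← rpow_mul hn0.le,
      div_eq_mul_inv, ← rpow_neg hn0.le]
    ring_nf
  have hexp (k a : ℕ) : -(c₁ * (k + 1) * a) / (2 * sqrt n) = -((k + 1) * t * a) := by
    rw [ht]
    field_simp
  simp only [hexp]
  set F : ℕ → ℝ := fun k => ∑' a : {a : ℕ | 0 < a ∧ ∃ i, a ≡ r i [MOD m]},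
    ((a : ℕ) : ℝ) * exp (-((k + 1) * t * (a : ℕ)))
  have hmain : HasSum (fun k : ℕ => ℓ / (m * (((k : ℝ) + 1) * t) ^ 2)) (n / (1 + ϑ)) := by
    have hval : (n : ℝ) / (1 + ϑ) = ℓ / (m * t ^ 2) * (π ^ 2 / 6) := by
      rw [ht, div_pow, div_pow, sq_sqrt hn0.le, hc₁sq]
      field_simp
      norm_num
    rw [hval]
    refine (hasSum_one_div_succ_sq.mul_left (ℓ / (m * t ^ 2))).congr_fun fun k => ?_
    rw [mul_pow, div_mul_div_comm, mul_one]
    ring_nf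
  have hbound (k : ℕ) : ‖F k - ℓ / (m * (((k : ℝ) + 1) * t) ^ 2)‖ ≤
      ℓ * (3 * m) * t ^ (-s) * ((k : ℝ) + 1) ^ (-s) := by
    have := abs_tsum_residueClasses_mul_exp_neg_sub_le m ℓ hm r hmono.injective hr1 hrm
      (x := (k + 1) * t) (by positivity) hs1.le hs2
    rw [mul_rpow (by positivity) htpos.le] at this
    rw [norm_eq_abs]
    linarith
  have hmajor := hZ.hasSum.mul_left (ℓ * (3 * m) * t ^ (-s))
  have hdiff := Summable.of_norm_bounded hmajor.summable hbound
  have hFsum : HasSum F ((∑' k, (F k - ℓ / (m * (((k : ℝ) + 1) * t) ^ 2))) + n / (1 + ϑ)) := by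
    simpa using hdiff.hasSum.add hmain
  rw [hFsum.tsum_eq, add_sub_cancel_right, ← norm_eq_abs]
  refine (tsum_of_norm_bounded hmajor hbound).trans ?_
  have hZ0 : 0 ≤ ∑' k : ℕ, ((k : ℝ) + 1) ^ (-s) := tsum_nonneg fun k => by positivity
  rw [htpow]
  calc ℓ * (3 * m) * ((c₁ / 2) ^ (-s) * (n : ℝ) ^ (s / 2)) * ∑' k : ℕ, ((k : ℝ) + 1) ^ (-s)
      = ℓ * (3 * m) * (c₁ / 2) ^ (-s) * (∑' k : ℕ, ((k : ℝ) + 1) ^ (-s)) * (n : ℝ) ^ (s / 2) := by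
        ring
    _ ≤ _ := by gcongr
end

section
/- Let m, ℓ, r_1, …, r_ℓ be positive integers with 1 ≤ r_1 < r_2 < ⋯ < r_ℓ ≤ m and gcd(r_1, …, r_ℓ, m) = 1. Let A be the set of all positive integers a such that a ≡ r_i (mod m) for some i ∈ {1, …, ℓ}, and let p_A(n) denote the number of partitions of n into parts belonging to A. Let c_0 = π√(2ℓ/(3m)) and let N_0 be such that p_A(n) ≥ 1 for all n ≥ N_0. Then for every ε with 0 < ε < 1/2 there exists a positive constant K = K(ε) such that p_A(n) ≥ K·exp(√(1−ε)·c_0·√n) for all integers n ≥ N_0. -/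
open Real

open Filter Topology

/-! ### A recurrence inequality for restricted partitions -/

/-- Adding `k` copies of the part `a` injects the partitions of `n - k * a` into the partitions
of `n` with at least `k` parts equal to `a`. -/
lemma partCount_sub_le_card (A : Set ℕ) [DecidablePred fun x => x ∈ A] {n a k : ℕ} (ha : a ∈ A)
    (ha0 : 0 < a) (hk : k * a ≤ n) :
    partCount A (n - k * a) ≤
      (Finset.univ.filter fun p : n.Partition =>
        (∀ i ∈ p.parts, i ∈ A) ∧ k ≤ p.parts.count a).card := by
  classical
  rw [partCount, Nat.card_eq_fintype_card, Fintype.card_subtype]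
  refine Finset.card_le_card_of_injOn
    (fun q => ⟨q.parts + Multiset.replicate k a, ?_, ?_⟩) ?_ ?_
  · intro i hi
    rcases Multiset.mem_add.1 hi with h | h
    · exact q.parts_pos h
    · rwa [Multiset.eq_of_mem_replicate h]
  · rw [Multiset.sum_add, q.parts_sum, Multiset.sum_replicate, smul_eq_mul]
    omega
  · intro q hq
    simp only [Finset.coe_filter, Finset.mem_univ, true_and, Set.mem_ofPred_eq] at hq ⊢
    refine ⟨fun i hi => ?_, by simp⟩
    rcases Multiset.mem_add.1 hi with h | h
    · exact hq i h
    · rwa [Multiset.eq_of_mem_replicate h]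
  · intro q _ q' _ h
    have hparts := congrArg Nat.Partition.parts h
    exact Nat.Partition.ext (by simpa using hparts)

/-- The total of the parts of a multiset dominates the sum of `a` over any finite set of pairs
`(a, k)` with `1 ≤ k ≤ count a`. -/
lemma sum_filter_le_multiset_sum (s : Multiset ℕ) (S : Finset (ℕ × ℕ))
    (hS : ∀ x ∈ S, 1 ≤ x.2) :
    ∑ x ∈ S with x.2 ≤ s.count x.1, x.1 ≤ s.sum := by
  have hsub : (S.filter fun x => x.2 ≤ s.count x.1) ⊆
      s.toFinset.biUnion fun a => (Finset.Icc 1 (s.count a)).image fun k => (a, k) := by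
    intro x hx
    obtain ⟨hx, hc⟩ := Finset.mem_filter.1 hx
    have h1 := hS x hx
    simp only [Finset.mem_biUnion, Finset.mem_image, Finset.mem_Icc, Multiset.mem_toFinset]
    exact ⟨x.1, Multiset.count_pos.1 (by omega), x.2, ⟨h1, hc⟩, rfl⟩
  refine (Finset.sum_le_sum_of_subset hsub).trans ?_
  rw [Finset.sum_biUnion, Finset.sum_multiset_count]
  · refine Finset.sum_le_sum fun a _ => ?_
    rw [Finset.sum_image (by intro x _ y _ h; simpa using h)]
    simp
  · intro a _ b _ hab
    simp only [Function.onFun, Finset.disjoint_left, Finset.mem_image]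
    rintro x ⟨k, _, rfl⟩ ⟨k', _, h⟩
    exact hab (Prod.mk.inj h).1.symm

lemma sum_mul_partCount_sub_le (A : Set ℕ) (n : ℕ) (S : Finset (ℕ × ℕ))
    (hS : ∀ x ∈ S, x.1 ∈ A ∧ 0 < x.1 ∧ 1 ≤ x.2 ∧ x.2 * x.1 ≤ n) :
    ∑ x ∈ S, x.1 * partCount A (n - x.2 * x.1) ≤ n * partCount A n := by
  classical
  calc ∑ x ∈ S, x.1 * partCount A (n - x.2 * x.1)
      ≤ ∑ x ∈ S, x.1 * (Finset.univ.filter fun p : n.Partition =>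
          (∀ i ∈ p.parts, i ∈ A) ∧ x.2 ≤ p.parts.count x.1).card :=
        Finset.sum_le_sum fun x hx => Nat.mul_le_mul_left _
          (partCount_sub_le_card A (hS x hx).1 (hS x hx).2.1 (hS x hx).2.2.2)
    _ = ∑ p : n.Partition with ∀ i ∈ p.parts, i ∈ A,
          ∑ x ∈ S with x.2 ≤ p.parts.count x.1, x.1 := by
        simp_rw [Finset.sum_filter (s := S)]
        rw [Finset.sum_comm]
        refine Finset.sum_congr rfl fun x _ => ?_
        rw [← Finset.sum_filter, Finset.filter_filter, Finset.sum_const, smul_eq_mul, mul_comm]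
    _ ≤ ∑ p : n.Partition with ∀ i ∈ p.parts, i ∈ A, n :=
        Finset.sum_le_sum fun p _ =>
          (sum_filter_le_multiset_sum p.parts S fun x hx => (hS x hx).2.2.1).trans_eq p.parts_sum
    _ = n * partCount A n := by
        rw [Finset.sum_const, smul_eq_mul, mul_comm, partCount, Nat.card_eq_fintype_card,
          Fintype.card_subtype]

/-! ### Analytic estimates -/

lemma sub_le_sq_mul_sum_mul_pow {q : ℝ} (h0 : 0 ≤ q) (h1 : q ≤ 1) (J : ℕ) :
    q - (J + 1) * q ^ J ≤ (1 - q) ^ 2 * ∑ j ∈ Finset.range J, (j : ℝ) * q ^ j := by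
  have h : (1 - q) ^ 2 * ∑ j ∈ Finset.range J, (j : ℝ) * q ^ j =
      q - J * q ^ J + (J - 1) * q ^ (J + 1) := by
    induction J with
    | zero => simp
    | succ J ih =>
      rw [Finset.sum_range_succ, mul_add, ih]
      push_cast
      ring
  rw [h]
  have h2 : q ^ (J + 1) ≤ q ^ J := pow_le_pow_of_le_one h0 h1 (Nat.le_succ J)
  have h3 : 0 ≤ (J : ℝ) * q ^ (J + 1) := by positivity
  linarith

lemma sub_le_sq_mul_sum_mul_exp_neg_pow {x : ℝ} (hx : 0 ≤ x) (J : ℕ) :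
    exp (-x) - (J + 1) * exp (-x) ^ J ≤
      x ^ 2 * ∑ j ∈ Finset.range J, (j : ℝ) * exp (-x) ^ j := by
  have h1 : exp (-x) ≤ 1 := exp_le_one_iff.2 (by linarith)
  refine (sub_le_sq_mul_sum_mul_pow (exp_pos _).le h1 J).trans ?_
  have h2 := add_one_le_exp (-x)
  have h3 : 1 - exp (-x) ≤ x := by linarith
  gcongr

lemma tendsto_mul_exp_neg_mul_sqrt {b : ℝ} (hb : 0 < b) :
    Tendsto (fun n : ℕ => (n : ℝ) * exp (-(b * √n))) atTop (𝓝 0) := by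
  have h := (tendsto_pow_mul_exp_neg_atTop_nhds_zero 2).comp
    ((tendsto_sqrt_atTop.comp tendsto_natCast_atTop_atTop).const_mul_atTop hb)
  have h' := h.const_mul (b ^ 2)⁻¹
  rw [mul_zero] at h'
  refine h'.congr fun n => ?_
  simp only [Function.comp]
  rw [mul_pow, sq_sqrt (Nat.cast_nonneg n)]
  field_simp

lemma tendsto_exp_neg_div_sqrt (b : ℝ) :
    Tendsto (fun n : ℕ => exp (-(b / √n))) atTop (𝓝 1) := by
  have h : Tendsto (fun n : ℕ => b / √(n : ℝ)) atTop (𝓝 0) :=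
    (tendsto_sqrt_atTop.comp tendsto_natCast_atTop_atTop).const_div_atTop b
  simpa [Function.comp_def] using (continuous_exp.tendsto _).comp h.neg

lemma tendsto_natDiv_mul_exp_pow {b : ℝ} (hb : 0 < b) {D : ℕ} (hD : 0 < D) :
    Tendsto (fun n : ℕ => ((n / D : ℕ) + 1 : ℝ) * exp (-(b / √n)) ^ (n / D)) atTop (𝓝 0) := by
  have hD' : (0 : ℝ) < D := Nat.cast_pos.2 hD
  have h := (tendsto_mul_exp_neg_mul_sqrt (div_pos hb hD')).const_mul (2 * exp b)
  rw [mul_zero] at h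
  refine squeeze_zero' (Eventually.of_forall fun n => by positivity) ?_ h
  filter_upwards [eventually_ge_atTop 1] with n hn
  have hn1 : (1 : ℝ) ≤ n := by exact_mod_cast hn
  have hs1 : 1 ≤ √(n : ℝ) := one_le_sqrt.2 hn1
  have hs0 : 0 < √(n : ℝ) := by linarith
  have hsq : √(n : ℝ) * √n = n := mul_self_sqrt (by linarith)
  have h1 : ((n / D : ℕ) + 1 : ℝ) ≤ 2 * n := by
    have : ((n / D : ℕ) : ℝ) ≤ n := by exact_mod_cast Nat.div_le_self n D
    linarith
  have h2 : (n : ℝ) / D - 1 ≤ (n / D : ℕ) := by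
    have : n < D * (n / D + 1) := Nat.lt_mul_div_succ n hD
    have : (n : ℝ) < D * ((n / D : ℕ) + 1) := by exact_mod_cast this
    rw [sub_le_iff_le_add, div_le_iff₀ hD']
    linarith
  have h3 : exp (-(b / √n)) ^ (n / D) ≤ exp b * exp (-(b / D * √n)) := by
    rw [← exp_nat_mul, ← exp_add, exp_le_exp]
    have h4 : b / √n ≤ b := div_le_self hb.le hs1
    have h5 : ((n : ℝ) / D - 1) * (b / √n) ≤ (n / D : ℕ) * (b / √n) :=
      mul_le_mul_of_nonneg_right h2 (by positivity)
    have h6 : (n : ℝ) / D * (b / √n) = b / D * √n := by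
      field_simp
      rw [sq, hsq]
    linarith
  calc _ ≤ 2 * n * (exp b * exp (-(b / D * √n))) := by gcongr
    _ = _ := by ring

/-- The sum of `M j e^{-βk(j+1)/√n}` over `j < n / D` and `1 ≤ k ≤ L` is asymptotically at least
`n M β⁻² ∑ 1 / k²`. -/
lemma eventually_le_sum_mul_exp {β : ℝ} (hβ : 0 < β) {D L : ℕ} (hD : 0 < D) {M : ℝ}
    (hM : 0 < M) (h : 1 < M / β ^ 2 * ∑ k ∈ Finset.Icc 1 L, 1 / (k : ℝ) ^ 2) :
    ∀ᶠ n : ℕ in atTop, (n : ℝ) ≤ ∑ k ∈ Finset.Icc 1 L, ∑ j ∈ Finset.range (n / D),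
      M * j * exp (-(β * k / √n * (j + 1))) := by
  have hlim : Tendsto (fun n : ℕ => M / β ^ 2 * ∑ k ∈ Finset.Icc 1 L, 1 / (k : ℝ) ^ 2 *
      (exp (-(β * k / √n)) * (exp (-(β * k / √n)) -
        ((n / D : ℕ) + 1 : ℝ) * exp (-(β * k / √n)) ^ (n / D)))) atTop
      (𝓝 (M / β ^ 2 * ∑ k ∈ Finset.Icc 1 L, 1 / (k : ℝ) ^ 2 * (1 * (1 - 0)))) := by
    refine (tendsto_finsetSum _ fun k hk => ?_).const_mul _
    have hk : (0 : ℝ) < k := Nat.cast_pos.2 (Finset.mem_Icc.1 hk).1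
    exact ((tendsto_exp_neg_div_sqrt _).mul ((tendsto_exp_neg_div_sqrt _).sub
      (tendsto_natDiv_mul_exp_pow (by positivity) hD))).const_mul _
  simp only [sub_zero, mul_one] at hlim
  filter_upwards [hlim.eventually_const_lt h, eventually_ge_atTop 1] with n hn hn1
  have hn0 : (0 : ℝ) < n := Nat.cast_pos.2 hn1
  have hs0 : 0 < √(n : ℝ) := sqrt_pos.2 hn0
  have hsq : √(n : ℝ) ^ 2 = n := sq_sqrt hn0.le
  refine (le_mul_of_one_le_right hn0.le hn.le).trans ?_
  rw [← mul_assoc, Finset.mul_sum]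
  refine Finset.sum_le_sum fun k hk => ?_
  have hk : (0 : ℝ) < k := Nat.cast_pos.2 (Finset.mem_Icc.1 hk).1
  set x := β * k / √n with hx
  have hx0 : 0 < x := by positivity
  have hgeom := sub_le_sq_mul_sum_mul_exp_neg_pow hx0.le (n / D)
  calc n * (M / β ^ 2) * (1 / (k : ℝ) ^ 2 * (exp (-x) *
          (exp (-x) - ((n / D : ℕ) + 1 : ℝ) * exp (-x) ^ (n / D))))
      = M / x ^ 2 * exp (-x) *
          (exp (-x) - ((n / D : ℕ) + 1 : ℝ) * exp (-x) ^ (n / D)) := by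
        rw [hx, div_pow, hsq]
        field_simp
    _ ≤ M / x ^ 2 * exp (-x) *
          (x ^ 2 * ∑ j ∈ Finset.range (n / D), (j : ℝ) * exp (-x) ^ j) := by gcongr
    _ = M * exp (-x) * ∑ j ∈ Finset.range (n / D), (j : ℝ) * exp (-x) ^ j := by
        field_simp
    _ = ∑ j ∈ Finset.range (n / D), M * j * exp (-(x * (j + 1))) := by
        rw [Finset.mul_sum]
        refine Finset.sum_congr rfl fun j _ => ?_
        rw [← exp_nat_mul, show -(x * ((j : ℝ) + 1)) = -x + j * -x by ring, exp_add]
        ring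

lemma sqrt_sub_ge {n y δ : ℝ} (hn : 0 < n) (hδ1 : δ ≤ 1) (hy0 : 0 ≤ y)
    (hy : y ≤ δ * n) : √n - (1 + δ) / 2 * y / √n ≤ √(n - y) := by
  have hs0 : 0 < √n := sqrt_pos.2 hn
  have hsq : √n ^ 2 = n := sq_sqrt hn.le
  have hδ0 : 0 ≤ δ := by
    by_contra hδ
    nlinarith
  refine le_sqrt_of_sq_le ?_
  have h : (√n - (1 + δ) / 2 * y / √n) ^ 2 =
      n - y - y / n * (δ * n - (1 + δ) ^ 2 / 4 * y) := by
    rw [sub_sq, div_pow, hsq]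
    field_simp
    ring
  rw [h]
  have h4 : (1 + δ) ^ 2 / 4 ≤ 1 := by nlinarith
  have : (1 + δ) ^ 2 / 4 * y ≤ y := mul_le_of_le_one_left hy0 h4
  have : 0 ≤ y / n * (δ * n - (1 + δ) ^ 2 / 4 * y) :=
    mul_nonneg (by positivity) (by linarith)
  linarith

/-- The strict inequality `c² < 4 u ζ(2)` survives truncating the series for `ζ(2)` and
enlarging `c` slightly. -/
lemma exists_delta_partial_sum {c u : ℝ}
    (h : c ^ 2 < 4 * u * (π ^ 2 / 6)) :
    ∃ δ : ℝ, 0 < δ ∧ δ ≤ 1 / 2 ∧ ∃ L : ℕ,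
      (c * (1 + δ)) ^ 2 < 4 * u * ∑ k ∈ Finset.Icc 1 L, 1 / (k : ℝ) ^ 2 := by
  have hcont : Tendsto (fun δ : ℝ => (c * (1 + δ)) ^ 2) (𝓝[>] 0) (𝓝 (c ^ 2)) := by
    have : Continuous fun δ : ℝ => (c * (1 + δ)) ^ 2 := by fun_prop
    simpa using (this.tendsto 0).mono_left nhdsWithin_le_nhds
  obtain ⟨δ, hδ, hδ0, hδ1⟩ := ((hcont.eventually_lt_const h).and
    (Ioc_mem_nhdsGT (show (0 : ℝ) < 1 / 2 by norm_num))).exists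
  have hsum := (hasSum_zeta_two.tendsto_sum_nat.comp (tendsto_add_atTop_nat 1)).const_mul (4 * u)
  obtain ⟨L, hL⟩ := (hsum.eventually_const_lt hδ).exists
  refine ⟨δ, hδ0, hδ1, L, ?_⟩
  have hIcc : ∑ k ∈ Finset.range (L + 1), 1 / (k : ℝ) ^ 2 =
      ∑ k ∈ Finset.Icc 1 L, 1 / (k : ℝ) ^ 2 := by
    rw [Finset.range_eq_Ico, Finset.sum_eq_sum_Ico_succ_bot (Nat.succ_pos L)]
    simp [Finset.Ico_add_one_right_eq_Icc]
  rw [← hIcc]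
  exact hL

lemma eq_and_eq_of_add_mul_eq {m ℓ : ℕ} {r : Fin ℓ → ℕ} (hmono : StrictMono r) (hr1 : ∀ i, 1 ≤ r i)
    (hrm : ∀ i, r i ≤ m) {i i' : Fin ℓ} {j j' : ℕ} (h : r i + m * j = r i' + m * j') :
    i = i' ∧ j = j' := by
  have h1 := hr1 i
  have h2 := hr1 i'
  have h3 := hrm i
  have h4 := hrm i'
  have hj : j = j' := by
    rcases lt_trichotomy j j' with hlt | heq | hlt
    · have := Nat.mul_le_mul_left m (Nat.succ_le_of_lt hlt)
      rw [Nat.mul_succ] at this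
      omega
    · exact heq
    · have := Nat.mul_le_mul_left m (Nat.succ_le_of_lt hlt)
      rw [Nat.mul_succ] at this
      omega
  subst hj
  exact ⟨hmono.injective (by omega), rfl⟩

/-- A lower bound `K e^{c √n'}` for all `n'` with `N₀ ≤ n' < n` propagates to `n`. -/
lemma le_partCount_of_forall_lt {m ℓ : ℕ} {r : Fin ℓ → ℕ}
    (hmono : StrictMono r) (hr1 : ∀ i, 1 ≤ r i) (hrm : ∀ i, r i ≤ m)
    {c δ K : ℝ} (hc : 0 < c) (hδ0 : 0 < δ) (hδ1 : δ ≤ 1 / 2) (hK : 0 < K) {N₀ n D L : ℕ}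
    (hn0 : 0 < n) (hn : 2 * N₀ ≤ n) (hD : L * m ≤ δ * D)
    (hsum : (n : ℝ) ≤ ∑ k ∈ Finset.Icc 1 L, ∑ j ∈ Finset.range (n / D),
      (ℓ * m : ℝ) * j * exp (-(c * (1 + δ) * m / 2 * k / √n * (j + 1))))
    (ih : ∀ n' < n, N₀ ≤ n' →
      K * exp (c * √n') ≤ (partCount {a : ℕ | 0 < a ∧ ∃ i, a ≡ r i [MOD m]} n' : ℝ)) :
    K * exp (c * √n) ≤ (partCount {a : ℕ | 0 < a ∧ ∃ i, a ≡ r i [MOD m]} n : ℝ) := by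
  set A := {a : ℕ | 0 < a ∧ ∃ i, a ≡ r i [MOD m]} with hA
  set T : Finset (ℕ × ℕ × Fin ℓ) :=
    Finset.Icc 1 L ×ˢ Finset.range (n / D) ×ˢ Finset.univ with hT
  set f : ℕ × ℕ × Fin ℓ → ℕ × ℕ := fun t => (r t.2.2 + m * t.2.1, t.1) with hf
  have hinj : Set.InjOn f T := by
    rintro ⟨k, j, i⟩ _ ⟨k', j', i'⟩ _ h
    simp only [hf, Prod.mk.injEq] at h
    obtain ⟨rfl, rfl⟩ := eq_and_eq_of_add_mul_eq hmono hr1 hrm h.1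
    rw [h.2]
  have hn0' : (0 : ℝ) < n := Nat.cast_pos.2 hn0
  have hs0 : 0 < √(n : ℝ) := sqrt_pos.2 hn0'
  have hle : ∀ t ∈ T, r t.2.2 + m * t.2.1 ≤ m * (t.2.1 + 1) := fun t _ => by
    have := hrm t.2.2
    rw [Nat.mul_succ]
    omega
  have hbound : ∀ t ∈ T, ((t.1 * (r t.2.2 + m * t.2.1) : ℕ) : ℝ) ≤ δ * n := by
    intro t ht
    simp only [hT, Finset.mem_product, Finset.mem_Icc, Finset.mem_range] at ht
    have h1 : t.1 * (r t.2.2 + m * t.2.1) ≤ L * (m * (n / D)) :=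
      Nat.mul_le_mul ht.1.2 ((hle t (by simpa [hT] using ht)).trans
        (Nat.mul_le_mul_left _ ht.2.1))
    have h2 : ((D * (n / D) : ℕ) : ℝ) ≤ n := by exact_mod_cast Nat.mul_div_le n D
    calc ((t.1 * (r t.2.2 + m * t.2.1) : ℕ) : ℝ) ≤ ((L * (m * (n / D)) : ℕ) : ℝ) := by
          exact_mod_cast h1
      _ = (L * m) * (n / D : ℕ) := by push_cast; ring
      _ ≤ δ * D * (n / D : ℕ) := by gcongr
      _ = δ * ((D * (n / D) : ℕ) : ℝ) := by push_cast; ring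
      _ ≤ δ * n := by gcongr
  have hhalf : ∀ t ∈ T, 2 * (t.1 * (r t.2.2 + m * t.2.1)) ≤ n := by
    intro t ht
    have h1 := hbound t ht
    have h2 : δ * n ≤ 1 / 2 * n := by gcongr
    have : 2 * ((t.1 * (r t.2.2 + m * t.2.1) : ℕ) : ℝ) ≤ n := by linarith
    exact_mod_cast this
  have hrec := sum_mul_partCount_sub_le A n (T.image f) (by
    intro x hx
    obtain ⟨t, ht, rfl⟩ := Finset.mem_image.1 hx
    have h1 := hhalf t ht
    have h2 := hr1 t.2.2
    simp only [hT, Finset.mem_product, Finset.mem_Icc] at ht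
    have h3 : 0 < r t.2.2 + m * t.2.1 := by omega
    exact ⟨⟨h3, t.2.2, by simp [hf, Nat.ModEq]⟩, h3, ht.1.1, by simp only [hf]; omega⟩)
  rw [Finset.sum_image hinj] at hrec
  have hterm : ∀ t ∈ T, K * exp (c * √n) *
      (m * t.2.1 * exp (-(c * (1 + δ) * m / 2 * t.1 / √n * (t.2.1 + 1)))) ≤
      (((f t).1 * partCount A (n - (f t).2 * (f t).1) : ℕ) : ℝ) := by
    intro t ht
    have h1 := hhalf t ht
    have hpos : 0 < t.1 * (r t.2.2 + m * t.2.1) := by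
      have := hr1 t.2.2
      simp only [hT, Finset.mem_product, Finset.mem_Icc] at ht
      exact Nat.mul_pos ht.1.1 (by omega)
    have hp := ih (n - t.1 * (r t.2.2 + m * t.2.1)) (by omega) (by omega)
    have hsqrt := sqrt_sub_ge hn0' (by linarith) (Nat.cast_nonneg _) (hbound t ht)
    rw [← Nat.cast_sub (by omega)] at hsqrt
    have ha : ((r t.2.2 + m * t.2.1 : ℕ) : ℝ) ≤ m * (t.2.1 + 1) := by exact_mod_cast hle t ht
    have hexp : c * √n + -(c * (1 + δ) * m / 2 * t.1 / √n * (t.2.1 + 1)) ≤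
        c * √((n - t.1 * (r t.2.2 + m * t.2.1) : ℕ) : ℝ) := by
      refine le_trans ?_ (mul_le_mul_of_nonneg_left hsqrt hc.le)
      have h2 : c * ((1 + δ) / 2 * ((t.1 * (r t.2.2 + m * t.2.1) : ℕ) : ℝ) / √n) ≤
          c * ((1 + δ) / 2 * (t.1 * (m * (t.2.1 + 1))) / √n) := by
        rw [Nat.cast_mul]
        gcongr
      have h3 : c * ((1 + δ) / 2 * (t.1 * (m * (t.2.1 + 1))) / √n) =
          c * (1 + δ) * m / 2 * t.1 / √n * (t.2.1 + 1) := by ring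
      linarith
    have hma : (m * t.2.1 : ℝ) ≤ ((r t.2.2 + m * t.2.1 : ℕ) : ℝ) := by
      push_cast
      linarith [(Nat.cast_nonneg (r t.2.2) : (0 : ℝ) ≤ _)]
    calc _ = (m * t.2.1 : ℝ) *
          (K * exp (c * √n + -(c * (1 + δ) * m / 2 * t.1 / √n * (t.2.1 + 1)))) := by
          rw [exp_add]; ring
      _ ≤ ((r t.2.2 + m * t.2.1 : ℕ) : ℝ) *
          (partCount A (n - t.1 * (r t.2.2 + m * t.2.1)) : ℝ) := by
          refine mul_le_mul hma (le_trans ?_ hp) (by positivity) (by positivity)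
          gcongr
      _ = _ := by rw [← Nat.cast_mul]
  have htotal : K * exp (c * √n) * n ≤ (n : ℝ) * partCount A n := by
    calc K * exp (c * √n) * n ≤ K * exp (c * √n) * ∑ t ∈ T,
          (m * t.2.1 * exp (-(c * (1 + δ) * m / 2 * t.1 / √n * (t.2.1 + 1)))) := by
          refine mul_le_mul_of_nonneg_left (hsum.trans_eq ?_) (by positivity)
          rw [hT, Finset.sum_product]
          refine Finset.sum_congr rfl fun k _ => ?_
          rw [Finset.sum_product]
          refine Finset.sum_congr rfl fun j _ => ?_
          simp only [Finset.sum_const, Finset.card_univ, Fintype.card_fin, nsmul_eq_mul]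
          ring
      _ ≤ ∑ t ∈ T, (((f t).1 * partCount A (n - (f t).2 * (f t).1) : ℕ) : ℝ) := by
          rw [Finset.mul_sum]
          exact Finset.sum_le_sum hterm
      _ ≤ (n : ℝ) * partCount A n := by exact_mod_cast hrec
  rw [mul_comm (n : ℝ)] at htotal
  exact le_of_mul_le_mul_right htotal hn0'

theorem stmt_17 (m ℓ : ℕ) (hm : 0 < m) (hℓ : 0 < ℓ) (r : Fin ℓ → ℕ)
    (hmono : StrictMono r) (hr1 : ∀ i, 1 ≤ r i) (hrm : ∀ i, r i ≤ m)
    (hgcd : Nat.gcd (Finset.univ.gcd r) m = 1)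
    (A : Set ℕ) (hA : A = {a : ℕ | 0 < a ∧ ∃ i, a ≡ r i [MOD m]})
    (c₀ : ℝ) (hc₀ : c₀ = π * Real.sqrt (2 * ℓ / (3 * m)))
    (N₀ : ℕ) (hN₀ : ∀ n : ℕ, N₀ ≤ n → 1 ≤ partCount A n)
    (ε : ℝ) (hε0 : 0 < ε) (hε1 : ε < 1 / 2) :
    ∃ K : ℝ, 0 < K ∧ ∀ n : ℕ, N₀ ≤ n →
      K * Real.exp (Real.sqrt (1 - ε) * c₀ * Real.sqrt n) ≤ (partCount A n : ℝ) := by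
  have hm' : (0 : ℝ) < m := Nat.cast_pos.2 hm
  have hℓ' : (0 : ℝ) < ℓ := Nat.cast_pos.2 hℓ
  have hc₀pos : 0 < c₀ := by rw [hc₀]; positivity
  have hc₀sq : c₀ ^ 2 = 4 * (ℓ / m) * (π ^ 2 / 6) := by
    rw [hc₀, mul_pow, sq_sqrt (by positivity)]
    field_simp
    norm_num
  set c := √(1 - ε) * c₀ with hc
  have hcpos : 0 < c := mul_pos (sqrt_pos.2 (by linarith)) hc₀pos
  have hclt : c ^ 2 < 4 * (ℓ / m) * (π ^ 2 / 6) := by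
    rw [hc, mul_pow, sq_sqrt (by linarith), ← hc₀sq]
    exact mul_lt_of_lt_one_left (by positivity) (by linarith)
  obtain ⟨δ, hδ0, hδ1, L, hL⟩ := exists_delta_partial_sum hclt
  obtain ⟨D, hD⟩ := exists_nat_ge (max 1 (L * m / δ))
  have hD0 : 0 < D := by
    have : (1 : ℝ) ≤ D := (le_max_left _ _).trans hD
    exact_mod_cast this
  have hDL : (L * m : ℝ) ≤ δ * D := by
    have := (le_max_right _ _).trans hD
    rw [div_le_iff₀ hδ0] at this
    linarith
  have hmain : 1 < (ℓ * m : ℝ) / (c * (1 + δ) * m / 2) ^ 2 *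
      ∑ k ∈ Finset.Icc 1 L, 1 / (k : ℝ) ^ 2 := by
    have h : (ℓ * m : ℝ) / (c * (1 + δ) * m / 2) ^ 2 * ∑ k ∈ Finset.Icc 1 L, 1 / (k : ℝ) ^ 2 =
        (4 * (ℓ / m) * ∑ k ∈ Finset.Icc 1 L, 1 / (k : ℝ) ^ 2) / (c * (1 + δ)) ^ 2 := by
      generalize ∑ k ∈ Finset.Icc 1 L, 1 / (k : ℝ) ^ 2 = s
      field_simp
      ring
    rw [h, one_lt_div (by positivity)]
    exact hL
  obtain ⟨N₁, hN₁⟩ := eventually_atTop.1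
    (eventually_le_sum_mul_exp (by positivity) hD0 (by positivity) hmain)
  set N := max N₁ (2 * N₀ + 1) with hN
  refine ⟨exp (-(c * √N)), exp_pos _, fun n => ?_⟩
  induction n using Nat.strong_induction_on with
  | _ n ih =>
    intro hn
    rcases le_total n N with hle | hge
    · have h1 : (1 : ℝ) ≤ partCount A n := by exact_mod_cast hN₀ n hn
      refine le_trans ?_ h1
      rw [← exp_add, exp_le_one_iff]
      have : √(n : ℝ) ≤ √N := sqrt_le_sqrt (by exact_mod_cast hle)
      nlinarith
    · have h1 : N₁ ≤ n := (le_max_left _ _).trans hge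
      have h2 : 2 * N₀ + 1 ≤ n := (le_max_right _ _).trans hge
      rw [hA] at ih ⊢
      exact le_partCount_of_forall_lt hmono hr1 hrm hcpos hδ0 hδ1 (exp_pos _) (by omega)
        (by omega) hDL (hN₁ n h1) ih
end
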